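/- arXiv:2601.15268 — 7 statements merged into one kernel-verified Lean document; each statement's English description precedes it below -/
import Mathlib

section
/- Let d be a positive squarefree integer with d ≡ 1 (mod 4), and let c, u, v, η be positive integers satisfying v·η·c² = u·lcm(c,d)². If d does not divide c, then Σ_{x=0}^{lcm(c,d)−1} Σ_{w=0}^{lcm(c,d)−1} χ_d(x)·χ_d(w)·S(x·w, u; c)·e((x·v + w·η)/lcm(c,d)) = 0. -/
open scoped BigOperators

/-- `e(t) = exp(2πi t)`. -/
noncomputable def eC (t : ℝ) : ℂ := Complex.exp (2 * Real.pi * Complex.I * t)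

/-- Kloosterman sum `S(a,b;c) = Σ_{γ ∈ (ℤ/cℤ)ˣ} e((aγ + bγ⁻¹)/c)`.
(For `c > 0` the type `(ZMod c)ˣ` is finite and `∑'` is the finite sum.) -/
noncomputable def kloosterman (a b : ℤ) (c : ℕ) : ℂ :=
  ∑' γ : (ZMod c)ˣ,
    eC (((a * ((γ : ZMod c).val : ℤ) + b * (((γ⁻¹ : (ZMod c)ˣ) : ZMod c).val : ℤ) : ℤ) : ℝ) / c)

lemma eC_div_congr {a b : ℤ} {n : ℕ} (hn : 0 < n) (h : a ≡ b [ZMOD n]) :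
    eC ((a : ℝ) / n) = eC ((b : ℝ) / n) := by
  obtain ⟨t, ht⟩ := h.symm.dvd
  have hn' : (n : ℂ) ≠ 0 := by exact_mod_cast hn.ne'
  have ha : (a : ℂ) = b + n * t := by
    have : a = b + n * t := by linarith
    exact_mod_cast this
  unfold eC
  rw [Complex.exp_eq_exp_iff_exists_int]
  refine ⟨t, ?_⟩
  push_cast
  rw [ha]
  field_simp

lemma kloosterman_congr_left {a a' : ℤ} (b : ℤ) {c : ℕ} (hc : 0 < c) (h : a ≡ a' [ZMOD c]) :
    kloosterman a b c = kloosterman a' b c := by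
  unfold kloosterman
  exact tsum_congr fun γ => eC_div_congr hc ((h.mul_right _).add_right _)

lemma sum_range_eq_zero_of_mul_mod_eq_neg {L k : ℕ} (hk : k.Coprime L) (F : ℕ → ℂ)
    (hF : ∀ x, F (k * x % L) = -F x) : ∑ x ∈ Finset.range L, F x = 0 := by
  rcases Nat.eq_zero_or_pos L with rfl | hL
  · simp
  have hmaps : Set.MapsTo (fun x => k * x % L) (Finset.range L) (Finset.range L) :=
    fun x _ => by simpa using Nat.mod_lt _ hL
  have hinj : Set.InjOn (fun x => k * x % L) (Finset.range L) := by
    intro x hx y hy hxy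
    have h : x ≡ y [MOD L] := Nat.ModEq.cancel_left_of_coprime hk.symm hxy
    exact h.eq_of_lt_of_lt (by simpa using hx) (by simpa using hy)
  have hsum : ∑ x ∈ Finset.range L, F (k * x % L) = ∑ x ∈ Finset.range L, F x :=
    Finset.sum_nbij (fun x => k * x % L) hmaps hinj
      (Finset.surjOn_of_injOn_of_card_le _ hmaps hinj le_rfl) fun _ _ => rfl
  simp only [hF, Finset.sum_neg_distrib] at hsum
  exact self_eq_neg.mp hsum.symm

lemma exists_jacobiSym_mul_eq_neg_one {p e N : ℕ} (hp : p.Prime) (hp2 : p ≠ 2) (he : e ∣ N)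
    (hpN : p.Coprime N) :
    ∃ k : ℕ, k.Coprime (p * N) ∧ k ≡ 1 [MOD N] ∧ jacobiSym k (p * e) = -1 := by
  have : Fact p.Prime := ⟨hp⟩
  obtain ⟨n, hn⟩ := FiniteField.exists_nonsquare (F := ZMod p) (by rwa [ZMod.ringChar_zmod_n])
  obtain ⟨k, hkp, hkN⟩ := Nat.chineseRemainder hpN n.val 1
  have hkn : (k : ZMod p) = n := by
    rw [(ZMod.natCast_eq_natCast_iff _ _ _).2 hkp, ZMod.natCast_zmod_val]
  have hcop : k.Coprime p := by
    rw [← ZMod.isUnit_iff_coprime, hkn, isUnit_iff_ne_zero]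
    rintro rfl
    exact hn IsSquare.zero
  refine ⟨k, hcop.mul_right ?_, hkN, ?_⟩
  · simpa [Nat.Coprime] using hkN.gcd_eq
  · have hleg : jacobiSym k p = -1 := by
      rw [← jacobiSym.legendreSym.to_jacobiSym, legendreSym.eq_neg_one_iff]
      simpa [hkn] using hn
    have hone : jacobiSym k e = 1 := by
      have h : ((k : ℕ) : ℤ) % e = 1 % e := by exact_mod_cast hkN.of_dvd he
      rw [jacobiSym.mod_left, h, ← jacobiSym.mod_left, jacobiSym.one_left]
    rcases Nat.eq_zero_or_pos e with rfl | hepos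
    · have hN : N = 0 := Nat.zero_dvd.mp he
      exact absurd (by simpa [hN] using hpN) hp.ne_one
    have : NeZero e := ⟨hepos.ne'⟩
    rw [jacobiSym.mul_right, hleg, hone, mul_one]

lemma sum_jacobiSym_mul_kloosterman_eq_zero {p e c N v : ℕ} (hp : p.Prime) (hp2 : p ≠ 2)
    (he : e ∣ N) (hcN : c ∣ N) (hc : 0 < c) (hN : 0 < N) (hpN : p.Coprime N) (hpv : p ∣ v)
    (w : ℤ) (u : ℤ) (b : ℕ) :
    ∑ x ∈ Finset.range (p * N), (jacobiSym (x : ℤ) (p * e) : ℂ) *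
      (kloosterman ((x : ℤ) * w) u c * eC (((x * v + b : ℕ) : ℝ) / (p * N : ℕ))) = 0 := by
  obtain ⟨k, hk, hk1, hkJ⟩ := exists_jacobiSym_mul_eq_neg_one hp hp2 he hpN
  refine sum_range_eq_zero_of_mul_mod_eq_neg hk _ fun x => ?_
  have hmod : k * x % (p * N) ≡ k * x [MOD p * N] := Nat.mod_modEq _ _
  have hmodN : k * x % (p * N) ≡ x [MOD N] := by
    simpa using (hmod.of_dvd (Dvd.intro_left p rfl)).trans (hk1.mul_right x)
  have hJ : jacobiSym ((k * x % (p * N) : ℕ) : ℤ) (p * e) = -jacobiSym x (p * e) := by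
    have h : ((k * x % (p * N) : ℕ) : ℤ) % (p * e : ℕ) = ((k * x : ℕ) : ℤ) % (p * e : ℕ) := by
      exact_mod_cast hmod.of_dvd (mul_dvd_mul_left p he)
    rw [jacobiSym.mod_left, h, ← jacobiSym.mod_left, Nat.cast_mul, jacobiSym.mul_left, hkJ,
      neg_one_mul]
  have hK : kloosterman (((k * x % (p * N) : ℕ) : ℤ) * w) u c = kloosterman ((x : ℤ) * w) u c :=
    kloosterman_congr_left _ hc
      ((Int.natCast_modEq_iff.2 (hmodN.of_dvd hcN)).mul_right w)
  have hE : eC (((k * x % (p * N) * v + b : ℕ) : ℝ) / (p * N : ℕ)) =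
      eC (((x * v + b : ℕ) : ℝ) / (p * N : ℕ)) := by
    obtain ⟨v', rfl⟩ := hpv
    have h : k * x % (p * N) * (p * v') + b ≡ x * (p * v') + b [MOD p * N] := by
      have := ((hmodN.mul_left' p).mul_right v').add_right b
      convert this using 1 <;> ring
    simpa only [Int.cast_natCast] using
      eC_div_congr (Nat.mul_pos hp.pos hN) (Int.natCast_modEq_iff.2 h)
  rw [hJ, hK, hE]
  push_cast
  ring

lemma exists_prime_dvd_not_dvd_of_squarefree {d c : ℕ} (hd : Squarefree d) (hnd : ¬ d ∣ c) :
    ∃ p, p.Prime ∧ p ∣ d ∧ ¬ p ∣ c := by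
  by_contra! h
  rw [← Nat.prod_primeFactors_of_squarefree hd] at hnd
  exact hnd (Finset.prod_primes_dvd c (fun p hp => (Nat.prime_of_mem_primeFactors hp).prime)
    fun p hp => h p (Nat.prime_of_mem_primeFactors hp) (Nat.dvd_of_mem_primeFactors hp))

theorem statement0 (d c u v η : ℕ) (hd : 0 < d) (hdsq : Squarefree d) (hdmod : d % 4 = 1)
    (hc : 0 < c) (hu : 0 < u) (hv : 0 < v) (hη : 0 < η)
    (hrel : v * η * c ^ 2 = u * (Nat.lcm c d) ^ 2) (hnd : ¬ d ∣ c) :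
    ∑ x ∈ Finset.range (Nat.lcm c d), ∑ w ∈ Finset.range (Nat.lcm c d),
      (jacobiSym (x : ℤ) d : ℂ) * (jacobiSym (w : ℤ) d : ℂ) *
        kloosterman ((x : ℤ) * (w : ℤ)) (u : ℤ) c *
        eC (((x * v + w * η : ℕ) : ℝ) / (Nat.lcm c d)) = 0 := by
  obtain ⟨p, hp, ⟨e, rfl⟩, hpc⟩ := exists_prime_dvd_not_dvd_of_squarefree hdsq hnd
  have hp2 : p ≠ 2 := by
    rintro rfl
    omega
  have hpc' : p.Coprime c := (hp.coprime_iff_not_dvd).2 hpc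
  have hpe : p.Coprime e := Nat.coprime_of_squarefree_mul hdsq
  have hpN : p.Coprime (c.lcm e) :=
    (hpc'.mul_right hpe).coprime_dvd_right (Nat.lcm_dvd_mul c e)
  have hlcm : c.lcm (p * e) = p * c.lcm e := by
    refine Nat.dvd_antisymm
      (Nat.lcm_dvd (dvd_mul_of_dvd_right (Nat.dvd_lcm_left c e) p)
        (mul_dvd_mul_left p (Nat.dvd_lcm_right c e)))
      (hpN.mul_dvd_of_dvd_of_dvd ?_ (Nat.lcm_dvd (Nat.dvd_lcm_left c (p * e))
        ((Dvd.intro_left p rfl).trans (Nat.dvd_lcm_right c (p * e)))))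
    exact (Dvd.intro e rfl).trans (Nat.dvd_lcm_right c (p * e))
  have hN : 0 < c.lcm e := Nat.lcm_pos hc (Nat.pos_of_mul_pos_left hd)
  have hpvη : p ∣ v * η := by
    have h : p ∣ v * η * c ^ 2 := by
      rw [hrel, hlcm]
      exact dvd_mul_of_dvd_right (dvd_pow (Dvd.intro _ rfl) two_ne_zero) u
    exact (hpc'.pow_right 2).dvd_of_dvd_mul_right h
  rw [hlcm]
  rcases hp.dvd_mul.1 hpvη with h | h
  · rw [Finset.sum_comm]
    refine Finset.sum_eq_zero fun w _ => ?_
    have := sum_jacobiSym_mul_kloosterman_eq_zero hp hp2 (Nat.dvd_lcm_right c e)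
      (Nat.dvd_lcm_left c e) hc hN hpN h w u (w * η)
    rw [← mul_zero (jacobiSym (w : ℤ) (p * e) : ℂ), ← this, Finset.mul_sum]
    exact Finset.sum_congr rfl fun x _ => by ring
  · refine Finset.sum_eq_zero fun x _ => ?_
    have := sum_jacobiSym_mul_kloosterman_eq_zero hp hp2 (Nat.dvd_lcm_right c e)
      (Nat.dvd_lcm_left c e) hc hN hpN h x u (x * v)
    rw [← mul_zero (jacobiSym (x : ℤ) (p * e) : ℂ), ← this, Finset.mul_sum]
    refine Finset.sum_congr rfl fun w _ => ?_
    rw [mul_comm (w : ℤ) x, add_comm (w * η)]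
    ring
end

section
/- Let d be a positive squarefree integer with d ≡ 1 (mod 4), and let c, u, v, η be positive integers satisfying v·η·c² = u·lcm(c,d)². If d divides c (so that lcm(c,d) = c and necessarily v·η = u), then Σ_{x=0}^{c−1} Σ_{w=0}^{c−1} χ_d(x)·χ_d(w)·S(x·w, u; c)·e((x·v + w·η)/c) = (c·φ(c)/φ(d)) · χ_d(u) · (−1)^{ω(d)} · ∏_{p prime, p ∣ d, p ∣ (c/d)} (1 − p), where ω(d) is the number of distinct prime factors of d. -/
open scoped BigOperators

/-- The Jacobi symbol `(· / d)` as a complex-valued Dirichlet character modulo `d`. -/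
noncomputable def jacobiChar (d : ℕ) [NeZero d] : DirichletCharacter ℂ d where
  toFun a := (jacobiSym (a.val : ℤ) d : ℂ)
  map_one' := by
    have h : jacobiSym (((1 : ZMod d).val : ℕ) : ℤ) d = jacobiSym 1 d := by
      rw [← Nat.cast_one (R := ZMod d), ZMod.val_natCast, Int.natCast_mod, ← jacobiSym.mod_left,
        Nat.cast_one]
    rw [h, jacobiSym.one_left, Int.cast_one]
  map_mul' a b := by
    rw [← Int.cast_mul, ← jacobiSym.mul_left, ZMod.val_mul, Int.natCast_mod,
      ← jacobiSym.mod_left, Nat.cast_mul]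
  map_nonunit' a ha := by
    rw [← ZMod.natCast_zmod_val a, ZMod.isUnit_iff_coprime] at ha
    have : jacobiSym (a.val : ℤ) d = 0 :=
      jacobiSym.eq_zero_iff_not_coprime.2 (by rwa [Int.gcd_natCast_natCast])
    change (jacobiSym (a.val : ℤ) d : ℂ) = 0
    rw [this, Int.cast_zero]

lemma jacobiChar_intCast (d : ℕ) [NeZero d] (x : ℤ) :
    jacobiChar d (x : ZMod d) = (jacobiSym x d : ℂ) := by
  change (jacobiSym (((x : ZMod d).val : ℕ) : ℤ) d : ℂ) = _
  rw [ZMod.val_intCast, ← jacobiSym.mod_left]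

lemma jacobiChar_natCast (d : ℕ) [NeZero d] (x : ℕ) :
    jacobiChar d (x : ZMod d) = (jacobiSym x d : ℂ) := by
  rw [← jacobiChar_intCast, Int.cast_natCast]

lemma jacobiChar_sq_of_isUnit {d : ℕ} [NeZero d] {a : ZMod d} (ha : IsUnit a) :
    jacobiChar d a ^ 2 = 1 := by
  rw [← ZMod.natCast_zmod_val a, ZMod.isUnit_iff_coprime] at ha
  rw [← ZMod.natCast_zmod_val a, jacobiChar_natCast]
  exact_mod_cast jacobiSym.sq_one (by rwa [Int.gcd_natCast_natCast])

lemma jacobiChar_mul_eq (m n : ℕ) [NeZero m] [NeZero n] (x : ZMod (m * n)) :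
    jacobiChar (m * n) x = jacobiChar m (x.cast : ZMod m) * jacobiChar n (x.cast : ZMod n) := by
  obtain ⟨k, rfl⟩ := ZMod.natCast_zmod_surjective x
  rw [ZMod.cast_natCast (dvd_mul_right m n), ZMod.cast_natCast (dvd_mul_left n m)]
  simp only [jacobiChar_natCast]
  rw [jacobiSym.mul_right, Int.cast_mul]

lemma jacobiChar_neg {d : ℕ} [NeZero d] (hd : d % 4 = 1) (a : ZMod d) :
    jacobiChar d (-a) = jacobiChar d a := by
  have h : jacobiChar d (-1) = 1 := by
    have := jacobiChar_intCast d (-1)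
    rw [jacobiSym.at_neg_one (Nat.odd_iff.2 (by omega)), ZMod.χ₄_nat_one_mod_four hd] at this
    simpa using this
  rw [← neg_one_mul, map_mul, h, one_mul]

/-- Modulo an odd prime the Jacobi symbol takes the value `-1`. -/
lemma exists_jacobiSym_eq_neg_one {p : ℕ} (hp : p.Prime) (hp2 : p ≠ 2) :
    ∃ s : ℕ, jacobiSym s p = -1 := by
  have := Fact.mk hp
  obtain ⟨a, ha⟩ := quadraticChar_exists_neg_one (F := ZMod p) (by rwa [ZMod.ringChar_zmod_n])
  refine ⟨a.val, ?_⟩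
  rw [← jacobiSym.legendreSym.to_jacobiSym, legendreSym]
  simpa using ha

/-- For a nonunit `y` modulo an odd squarefree `d`, some `s` fixes `y` and has symbol `-1`. -/
lemma exists_mul_eq_self_jacobiChar_eq_neg_one {d : ℕ} [NeZero d] (hsq : Squarefree d)
    (hodd : Odd d) {y : ZMod d} (hy : ¬ IsUnit y) :
    ∃ s : ZMod d, y * s = y ∧ jacobiChar d s = -1 := by
  obtain ⟨k, rfl⟩ := ZMod.natCast_zmod_surjective y
  rw [ZMod.isUnit_iff_coprime, Nat.Prime.not_coprime_iff_dvd] at hy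
  obtain ⟨p, hp, hpk, n, rfl⟩ := hy
  have hcop : p.Coprime n := Nat.coprime_of_squarefree_mul hsq
  have hp0 : NeZero p := ⟨hp.ne_zero⟩
  have hn0 : NeZero n := ⟨by rintro rfl; simp at hodd⟩
  have hp2 : p ≠ 2 := by rintro rfl; simp [Nat.odd_mul] at hodd; exact absurd hodd.1 (by decide)
  obtain ⟨t, ht⟩ := exists_jacobiSym_eq_neg_one hp hp2
  obtain ⟨s, hs1, hs2⟩ := Nat.chineseRemainder hcop t 1
  refine ⟨s, ?_, ?_⟩
  · rw [← Nat.cast_mul, ZMod.natCast_eq_natCast_iff]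
    rw [← Nat.modEq_and_modEq_iff_modEq_mul hcop]
    constructor
    · exact ((Nat.modEq_zero_iff_dvd.2 (hpk.mul_right s))).trans (Nat.modEq_zero_iff_dvd.2 hpk).symm
    · simpa using hs2.mul_left k
  · rw [jacobiChar_mul_eq, ZMod.cast_natCast (dvd_mul_right p n),
      ZMod.cast_natCast (dvd_mul_left n p), (ZMod.natCast_eq_natCast_iff _ _ _).2 hs1,
      (ZMod.natCast_eq_natCast_iff _ _ _).2 hs2, jacobiChar_natCast, ht]
    simp

/-- The Gauss sum of the Jacobi symbol at any frequency, units or not. -/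
lemma sum_jacobiChar_mul_stdAddChar {d : ℕ} [NeZero d] (hsq : Squarefree d) (hodd : Odd d)
    (y : ZMod d) :
    ∑ w, jacobiChar d w * ZMod.stdAddChar (y * w) =
      jacobiChar d y * ∑ w, jacobiChar d w * ZMod.stdAddChar w := by
  by_cases hy : IsUnit y
  · obtain ⟨u, rfl⟩ := hy
    rw [Finset.mul_sum, ← Equiv.sum_comp (Units.mulLeft u)
      (fun w ↦ jacobiChar d u * (jacobiChar d w * ZMod.stdAddChar w))]
    refine Finset.sum_congr rfl fun w _ ↦ ?_
    have h := jacobiChar_sq_of_isUnit u.isUnit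
    simp only [Units.mulLeft_apply, map_mul]
    linear_combination (-jacobiChar d w * ZMod.stdAddChar (N := d) (u * w)) * h
  · rw [MulChar.map_nonunit _ hy, zero_mul]
    obtain ⟨s, hs, hχ⟩ := exists_mul_eq_self_jacobiChar_eq_neg_one hsq hodd hy
    have hsu : IsUnit s := by
      by_contra h
      rw [MulChar.map_nonunit _ h] at hχ
      norm_num at hχ
    obtain ⟨u, rfl⟩ := hsu
    have key : ∑ w, jacobiChar d w * ZMod.stdAddChar (y * w) =
        -∑ w, jacobiChar d w * ZMod.stdAddChar (y * w) := by
      conv_lhs => rw [← Equiv.sum_comp (Units.mulLeft u)]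
      rw [← Finset.sum_neg_distrib]
      refine Finset.sum_congr rfl fun w _ ↦ ?_
      rw [Units.mulLeft_apply, ← mul_assoc, hs, map_mul, hχ]
      ring
    exact self_eq_neg.1 key

/-- The square of the Gauss sum of the Jacobi symbol, for `d ≡ 1 (mod 4)`. -/
lemma sq_sum_jacobiChar_mul_stdAddChar {d : ℕ} [NeZero d] (hsq : Squarefree d)
    (hd : d % 4 = 1) :
    (∑ w, jacobiChar d w * ZMod.stdAddChar w) ^ 2 = (d : ℂ) := by
  have hodd : Odd d := Nat.odd_iff.2 (by omega)
  set τ := ∑ w, jacobiChar d w * ZMod.stdAddChar w with hτ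
  have h1 : ∑ a : ZMod d, (∑ w, jacobiChar d w * ZMod.stdAddChar (a * w)) *
      ZMod.stdAddChar (-a) = τ ^ 2 := by
    simp only [sum_jacobiChar_mul_stdAddChar hsq hodd, ← hτ]
    rw [← Equiv.sum_comp (Equiv.neg _)]
    simp only [Equiv.neg_apply, neg_neg, jacobiChar_neg hd]
    rw [sq, hτ, Finset.sum_mul]
    exact Finset.sum_congr rfl fun a _ ↦ by ring
  have h2 : ∑ a : ZMod d, (∑ w, jacobiChar d w * ZMod.stdAddChar (a * w)) *
      ZMod.stdAddChar (-a) =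
      ∑ w, jacobiChar d w * ∑ a, ZMod.stdAddChar (a * (w - 1)) := by
    simp only [Finset.sum_mul, Finset.mul_sum]
    rw [Finset.sum_comm]
    refine Finset.sum_congr rfl fun w _ ↦ Finset.sum_congr rfl fun a _ ↦ ?_
    rw [mul_assoc, ← AddChar.map_add_eq_mul]
    congr 2
    ring
  rw [← h1, h2]
  simp only [AddChar.sum_mulShift _ (ZMod.isPrimitive_stdAddChar d), ZMod.card, sub_eq_zero]
  rw [Finset.sum_eq_single 1] <;> simp +contextual

/-- Summing along a surjective homomorphism of finite groups: all fibres have the same size. -/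
@[to_additive]
lemma sum_comp_monoidHom_of_surjective {G H : Type*} [Group G] [Group H] [Fintype G] [Fintype H]
    [DecidableEq H] (f : G →* H) (hf : Function.Surjective f) (F : H → ℂ) :
    ∑ g, F (f g) = ((Fintype.card G : ℂ) / Fintype.card H) * ∑ h, F h := by
  have key (F : H → ℂ) :
      ∑ g, F (f g) = ((Finset.univ.filter fun g ↦ f g = 1).card : ℂ) * ∑ h, F h := by
    rw [← Finset.sum_fiberwise Finset.univ f, Finset.mul_sum]
    refine Finset.sum_congr rfl fun h _ ↦ ?_
    rw [Finset.sum_congr rfl (g := fun _ ↦ F h) (by simp +contextual), Finset.sum_const,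
      nsmul_eq_mul, MonoidHom.card_fiber_eq_of_mem_range f (hf h) (hf 1)]
  have h1 := key fun _ ↦ 1
  have h0 : (Fintype.card H : ℂ) ≠ 0 := by exact_mod_cast Fintype.card_ne_zero
  simp only [Finset.sum_const, Finset.card_univ, nsmul_eq_mul, mul_one] at h1
  rw [key, h1, mul_div_cancel_right₀ _ h0]

/-- Two-factor multiplicativity of `∑ χ(y)² χ(m y + a)`. -/
lemma sum_sq_jacobiChar_mul (p n : ℕ) [NeZero p] [NeZero n] (h : p.Coprime n) (m a : ℤ) :
    ∑ y : ZMod (p * n), jacobiChar (p * n) y ^ 2 * jacobiChar (p * n) (m * y + a) =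
      (∑ y : ZMod p, jacobiChar p y ^ 2 * jacobiChar p (m * y + a)) *
        ∑ y : ZMod n, jacobiChar n y ^ 2 * jacobiChar n (m * y + a) := by
  rw [Finset.sum_mul_sum, ← Fintype.sum_prod_type',
    ← Equiv.sum_comp (ZMod.chineseRemainder h).toEquiv]
  refine Finset.sum_congr rfl fun y _ ↦ ?_
  obtain ⟨k, rfl⟩ := ZMod.intCast_surjective y
  have e : (ZMod.chineseRemainder h).toEquiv (k : ZMod (p * n)) = ((k : ZMod p), (k : ZMod n)) := by
    change ZMod.chineseRemainder h _ = _
    rw [map_intCast]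
    rfl
  rw [e]
  simp only [← Int.cast_mul, ← Int.cast_add, jacobiChar_intCast, jacobiSym.mul_right]
  push_cast
  ring

lemma sum_sq_jacobiChar_prime {p : ℕ} [NeZero p] (hp : p.Prime) (hp2 : p ≠ 2) (m : ℕ) (a : ℤ) :
    ∑ y : ZMod p, jacobiChar p y ^ 2 * jacobiChar p (((m : ℤ) : ZMod p) * y + a) =
      jacobiChar p a * (-1 * if p ∣ m then 1 - (p : ℂ) else 1) := by
  have := Fact.mk hp
  have hz : jacobiChar p 0 = 0 := MulChar.map_nonunit _ not_isUnit_zero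
  have hsum (f : ZMod p → ℂ) : ∑ y : ZMod p, jacobiChar p y ^ 2 * f y = ∑ y, f y - f 0 := by
    rw [← Finset.add_sum_erase _ _ (Finset.mem_univ (0 : ZMod p)),
      ← Finset.add_sum_erase _ f (Finset.mem_univ (0 : ZMod p)), hz]
    rw [Finset.sum_congr rfl (g := f) fun y hy ↦ by
      rw [jacobiChar_sq_of_isUnit (isUnit_iff_ne_zero.2 (Finset.ne_of_mem_erase hy)), one_mul]]
    ring
  rw [hsum]
  split_ifs with h
  · have : ((m : ℤ) : ZMod p) = 0 := by
      rw [Int.cast_natCast]; exact (ZMod.natCast_eq_zero_iff _ _).2 h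
    simp only [this, zero_mul, zero_add, Finset.sum_const, Finset.card_univ, ZMod.card,
      nsmul_eq_mul]
    ring
  · have hm : ((m : ℤ) : ZMod p) ≠ 0 := by
      rw [Int.cast_natCast]; exact fun h' ↦ h ((ZMod.natCast_eq_zero_iff _ _).1 h')
    have h0 := sum_jacobiChar_mul_stdAddChar (d := p) hp.prime.squarefree (hp.odd_of_ne_two hp2) 0
    simp only [zero_mul, AddChar.map_zero_eq_one, mul_one, hz] at h0
    have h1 := Equiv.sum_comp ((Equiv.mulLeft₀ _ hm).trans (Equiv.addRight (a : ZMod p)))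
      (fun y ↦ jacobiChar p y)
    simp only [Equiv.trans_apply, Equiv.mulLeft₀_apply, Equiv.coe_addRight] at h1
    rw [h1, h0]
    simp

lemma sum_sq_jacobiChar (m : ℕ) (a : ℤ) {d : ℕ} [NeZero d] (hsq : Squarefree d) (hodd : Odd d) :
    ∑ y : ZMod d, jacobiChar d y ^ 2 * jacobiChar d (((m : ℤ) : ZMod d) * y + a) =
      jacobiChar d a * ∏ p ∈ d.primeFactors, (-1 * if p ∣ m then 1 - (p : ℂ) else 1) := by
  rename_i inst
  induction d using Nat.recOnMul generalizing inst with
  | zero => simp at hodd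
  | one => simp [Finset.univ_unique, Subsingleton.elim _ (1 : ZMod 1)]
  | prime p hp =>
    rw [sum_sq_jacobiChar_prime hp (by rintro rfl; exact absurd hodd (by decide)),
      hp.primeFactors, Finset.prod_singleton]
  | mul k n hk hn =>
    have hcop : k.Coprime n := Nat.coprime_of_squarefree_mul hsq
    have hodd' := Nat.odd_mul.1 hodd
    have : NeZero k := ⟨by rintro rfl; simp at hodd⟩
    have : NeZero n := ⟨by rintro rfl; simp at hodd⟩
    rw [sum_sq_jacobiChar_mul k n hcop, hk hsq.of_mul_left hodd'.1, hn hsq.of_mul_right hodd'.2,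
      hcop.primeFactors_mul, Finset.prod_union hcop.disjoint_primeFactors]
    simp only [jacobiChar_intCast, jacobiSym.mul_right]
    push_cast
    ring

lemma sum_range_natCast (c : ℕ) [NeZero c] (f : ZMod c → ℂ) :
    ∑ x ∈ Finset.range c, f x = ∑ x, f x :=
  Finset.sum_bij' (fun x _ ↦ (x : ZMod c)) (fun x _ ↦ x.val) (by simp)
    (fun x _ ↦ Finset.mem_range.2 (ZMod.val_lt x))
    (fun x hx ↦ ZMod.val_cast_of_lt (Finset.mem_range.1 hx)) (by simp) (by simp)

lemma eC_intCast_div (c : ℕ) [NeZero c] (k : ℤ) :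
    eC ((k : ℝ) / c) = ZMod.stdAddChar (k : ZMod c) := by
  rw [ZMod.stdAddChar_coe, eC]
  push_cast
  ring_nf

lemma kloosterman_eq_sum (a b : ℤ) (c : ℕ) [NeZero c] :
    kloosterman a b c =
      ∑ γ : (ZMod c)ˣ, ZMod.stdAddChar (N := c)
        (a * (γ : ZMod c) + b * ((γ⁻¹ : (ZMod c)ˣ) : ZMod c)) := by
  rw [kloosterman, tsum_fintype]
  refine Finset.sum_congr rfl fun γ _ ↦ ?_
  rw [eC_intCast_div]
  simp

lemma stdAddChar_natCast_mul (d m : ℕ) [NeZero d] [NeZero m] (z : ZMod (d * m)) :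
    ZMod.stdAddChar ((m : ZMod (d * m)) * z) =
      ZMod.stdAddChar (ZMod.castHom (dvd_mul_right d m) (ZMod d) z) := by
  obtain ⟨k, rfl⟩ := ZMod.intCast_surjective z
  have : ((m : ZMod (d * m)) * (k : ZMod (d * m))) = (((m : ℤ) * k : ℤ) : ZMod (d * m)) := by
    push_cast; rfl
  rw [this, map_intCast (ZMod.castHom (dvd_mul_right d m) (ZMod d)), ZMod.stdAddChar_coe,
    ZMod.stdAddChar_coe]
  congr 1
  have hm : (m : ℂ) ≠ 0 := Nat.cast_ne_zero.2 (NeZero.ne m)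
  have hd : (d : ℂ) ≠ 0 := Nat.cast_ne_zero.2 (NeZero.ne d)
  push_cast
  field_simp

/-- A function on `ℤ/dmℤ` supported on the `d`-torsion is summed over the multiples of `m`. -/
lemma sum_eq_sum_natCast_mul (d m : ℕ) [NeZero d] [NeZero m] (F : ZMod (d * m) → ℂ)
    (hF : ∀ x : ZMod (d * m), x * d ≠ 0 → F x = 0) :
    ∑ x, F x = ∑ y : ZMod d, F (m * (y.val : ZMod (d * m))) := by
  symm
  refine Finset.sum_of_injOn (fun y : ZMod d ↦ (m : ZMod (d * m)) * (y.val : ZMod (d * m)))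
    ?_ (by simp) ?_ (by simp)
  · intro y _ y' _ h
    simp only [← Nat.cast_mul] at h
    rw [ZMod.natCast_eq_natCast_iff, mul_comm d m] at h
    have := (Nat.ModEq.mul_left_cancel_iff' (NeZero.ne m)).1 h
    exact ZMod.val_injective d (this.eq_of_lt_of_lt (ZMod.val_lt y) (ZMod.val_lt y'))
  · intro x _ hx
    apply hF
    contrapose! hx
    obtain ⟨k, rfl⟩ := ZMod.natCast_zmod_surjective x
    rw [← Nat.cast_mul, ZMod.natCast_eq_zero_iff, mul_comm k d] at hx
    obtain ⟨n, rfl⟩ := Nat.dvd_of_mul_dvd_mul_left (NeZero.pos d) hx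
    refine ⟨(n : ZMod d), by simp, ?_⟩
    simp only [ZMod.val_natCast, ← Nat.cast_mul]
    rw [ZMod.natCast_eq_natCast_iff, mul_comm d m]
    exact (Nat.mod_modEq n d).mul_left' m

/-- Fourier transform modulo `dm` of a `d`-periodic function, away from the multiples of `m`. -/
lemma sum_periodic_mul_stdAddChar_eq_zero (d m : ℕ) [NeZero d] [NeZero m] (g : ZMod d → ℂ)
    {a : ZMod (d * m)} (ha : a * d ≠ 0) :
    ∑ w, g (ZMod.castHom (dvd_mul_right d m) (ZMod d) w) * ZMod.stdAddChar (a * w) = 0 := by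
  set S := ∑ w, g (ZMod.castHom (dvd_mul_right d m) (ZMod d) w) * ZMod.stdAddChar (a * w) with hS
  have h : S = ZMod.stdAddChar (N := d * m) (a * d) * S := by
    conv_lhs => rw [hS, ← Equiv.sum_comp (Equiv.addRight (d : ZMod (d * m)))]
    rw [hS, Finset.mul_sum]
    refine Finset.sum_congr rfl fun w _ ↦ ?_
    simp only [Equiv.coe_addRight, map_add, map_natCast, CharP.cast_eq_zero, add_zero, mul_add,
      AddChar.map_add_eq_mul]
    ring
  have h1 : ZMod.stdAddChar (N := d * m) (a * d) ≠ 1 := fun h1 ↦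
    ha (ZMod.injective_stdAddChar (h1.trans (AddChar.map_zero_eq_one _).symm))
  have h2 : (ZMod.stdAddChar (N := d * m) (a * d) - 1) * S = 0 := by linear_combination -h
  exact (mul_eq_zero.1 h2).resolve_left (sub_ne_zero.2 h1)

/-- Completing the product in the phase: `γ(x + ηγ⁻¹)(w + vγ⁻¹)`. -/
lemma sum_kloosterman_phase (d c : ℕ) [NeZero d] [NeZero c] (hdc : d ∣ c) (v η : ZMod c) :
    ∑ x : ZMod c, ∑ w : ZMod c, jacobiChar d (ZMod.castHom hdc (ZMod d) x) *
      jacobiChar d (ZMod.castHom hdc (ZMod d) w) *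
        (∑ γ : (ZMod c)ˣ, ZMod.stdAddChar (x * w * (γ : ZMod c) +
          v * η * ((γ⁻¹ : (ZMod c)ˣ) : ZMod c))) * ZMod.stdAddChar (x * v + w * η) =
    ∑ γ : (ZMod c)ˣ, ∑ x : ZMod c, jacobiChar d (ZMod.castHom hdc (ZMod d) (x - η)) *
      ∑ w : ZMod c, jacobiChar d (ZMod.castHom hdc (ZMod d) (w - v)) *
        ZMod.stdAddChar (N := c) (γ * x * w) := by
  set χ : ZMod c → ℂ := fun x ↦ jacobiChar d (ZMod.castHom hdc (ZMod d) x) with hχ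
  have hχmul (x y) : χ (x * y) = χ x * χ y := by simp only [hχ, map_mul]
  have hχsq (γ : (ZMod c)ˣ) : χ γ ^ 2 = 1 :=
    jacobiChar_sq_of_isUnit (γ.isUnit.map (ZMod.castHom hdc (ZMod d)))
  change ∑ x, ∑ w, χ x * χ w * _ * _ = ∑ γ : (ZMod c)ˣ, ∑ x, χ (x - η) * ∑ w, χ (w - v) * _
  simp only [Finset.mul_sum, Finset.sum_mul]
  rw [Finset.sum_congr rfl fun x _ ↦ Finset.sum_comm, Finset.sum_comm,
    ← Equiv.sum_comp (Equiv.inv (ZMod c)ˣ)]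
  refine Finset.sum_congr rfl fun γ _ ↦ ?_
  rw [← Equiv.sum_comp ((Equiv.subRight η).trans (Units.mulLeft γ))]
  refine Finset.sum_congr rfl fun x _ ↦ ?_
  rw [← Equiv.sum_comp ((Equiv.subRight v).trans (Units.mulLeft γ))]
  refine Finset.sum_congr rfl fun w _ ↦ ?_
  simp only [Equiv.trans_apply, Equiv.subRight_apply, Units.mulLeft_apply, Equiv.inv_apply,
    inv_inv, hχmul]
  rw [mul_assoc _ (ZMod.stdAddChar _) (ZMod.stdAddChar _), ← AddChar.map_add_eq_mul]
  have e : (γ : ZMod c) * (x - η) * (γ * (w - v)) * ((γ⁻¹ : (ZMod c)ˣ) : ZMod c) + v * η * γ +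
      (γ * (x - η) * v + γ * (w - v) * η) = γ * x * w := by
    linear_combination (γ * (x - η) * (w - v)) * γ.mul_inv
  rw [e]
  linear_combination (χ (x - η) * χ (w - v) * ZMod.stdAddChar (N := c) (γ * x * w)) * hχsq γ

lemma sum_sub_jacobiChar_mul_stdAddChar {d : ℕ} [NeZero d] (hsq : Squarefree d) (hodd : Odd d)
    (v a : ZMod d) :
    ∑ w, jacobiChar d (w - v) * ZMod.stdAddChar (a * w) =
      jacobiChar d a * ZMod.stdAddChar (a * v) * ∑ w, jacobiChar d w * ZMod.stdAddChar w := by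
  rw [mul_right_comm, ← sum_jacobiChar_mul_stdAddChar hsq hodd, Finset.sum_mul,
    ← Equiv.sum_comp (Equiv.addRight v)]
  refine Finset.sum_congr rfl fun w _ ↦ ?_
  simp only [Equiv.coe_addRight, add_sub_cancel_right, mul_add, AddChar.map_add_eq_mul]
  ring

lemma sum_units_jacobiChar_mul_stdAddChar {d : ℕ} [NeZero d] (v : ZMod d) :
    ∑ γ : (ZMod d)ˣ, jacobiChar d γ * ZMod.stdAddChar (N := d) (v * γ) =
      ∑ w, jacobiChar d w * ZMod.stdAddChar (v * w) := by
  refine Finset.sum_of_injOn (fun γ : (ZMod d)ˣ ↦ (γ : ZMod d)) (fun _ _ _ _ h ↦ Units.ext h)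
    (by simp) ?_ (by simp)
  intro w _ hw
  rw [MulChar.map_nonunit, zero_mul]
  rintro ⟨u, rfl⟩
  exact hw ⟨u, by simp, rfl⟩

/-- The sum over `γ` and `w` in the reduced problem modulo `d`. -/
lemma sum_units_sum_sub_jacobiChar {d : ℕ} [NeZero d] (hsq : Squarefree d) (hd : d % 4 = 1)
    (v y : ZMod d) :
    ∑ γ : (ZMod d)ˣ, ∑ w, jacobiChar d (w - v) * ZMod.stdAddChar (N := d) (γ * y * w) =
      d * jacobiChar d v * jacobiChar d y ^ 2 := by
  have hodd : Odd d := Nat.odd_iff.2 (by omega)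
  simp only [sum_sub_jacobiChar_mul_stdAddChar hsq hodd, ← Finset.sum_mul, map_mul]
  have h : ∑ γ : (ZMod d)ˣ, jacobiChar d γ * jacobiChar d y *
        ZMod.stdAddChar (N := d) (γ * y * v) =
      jacobiChar d y *
        (jacobiChar d (y * v) * ∑ w, jacobiChar d w * ZMod.stdAddChar w) := by
    rw [← sum_jacobiChar_mul_stdAddChar hsq hodd, ← sum_units_jacobiChar_mul_stdAddChar,
      Finset.mul_sum]
    refine Finset.sum_congr rfl fun γ _ ↦ ?_
    rw [show (γ : ZMod d) * y * v = y * v * γ by ring]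
    ring
  rw [h, map_mul]
  linear_combination (jacobiChar d y ^ 2 * jacobiChar d v) *
    sq_sum_jacobiChar_mul_stdAddChar hsq hd

lemma sum_kloosterman_phase_eq {d m : ℕ} [NeZero d] [NeZero m] (hsq : Squarefree d)
    (hd : d % 4 = 1) (v η : ℤ) :
    ∑ γ : (ZMod (d * m))ˣ, ∑ x : ZMod (d * m),
      jacobiChar d (ZMod.castHom (dvd_mul_right d m) (ZMod d) (x - η)) *
      ∑ w : ZMod (d * m), jacobiChar d (ZMod.castHom (dvd_mul_right d m) (ZMod d) (w - v)) *
        ZMod.stdAddChar (N := d * m) (γ * x * w) =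
    ((d * m : ℕ) : ℂ) * ((d * m).totient / d.totient) * jacobiChar d v *
      (jacobiChar d η * ∏ p ∈ d.primeFactors, (-1 * if p ∣ m then 1 - (p : ℂ) else 1)) := by
  have hodd : Odd d := Nat.odd_iff.2 (by omega)
  have hd0 : (d : ℂ) ≠ 0 := Nat.cast_ne_zero.2 (NeZero.ne d)
  set π := ZMod.castHom (dvd_mul_right d m) (ZMod d) with hπ
  have hw (γ : (ZMod (d * m))ˣ) (y : ZMod d) :
      ∑ w : ZMod (d * m), jacobiChar d (π (w - v)) *
        ZMod.stdAddChar (N := d * m) (γ * (m * (y.val : ZMod (d * m))) * w) =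
      m * ∑ w : ZMod d, jacobiChar d (w - v) *
        ZMod.stdAddChar (N := d) (ZMod.unitsMap (dvd_mul_right d m) γ * y * w) := by
    have h := sum_comp_addMonoidHom_of_surjective (π : ZMod (d * m) →+ ZMod d)
      (ZMod.castHom_surjective (dvd_mul_right d m)) fun w ↦ jacobiChar d (w - v) *
        ZMod.stdAddChar (N := d) (ZMod.unitsMap (dvd_mul_right d m) γ * y * w)
    rw [ZMod.card, ZMod.card, Nat.cast_mul, mul_div_cancel_left₀ _ hd0] at h
    rw [← h]
    refine Finset.sum_congr rfl fun w _ ↦ ?_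
    rw [show (γ : ZMod (d * m)) * (m * (y.val : ZMod (d * m))) * w =
      m * (γ * (y.val : ZMod (d * m)) * w) by ring, stdAddChar_natCast_mul]
    simp [← hπ, ZMod.unitsMap_def]
  have hx (γ : (ZMod (d * m))ˣ) :
      ∑ x : ZMod (d * m), jacobiChar d (π (x - η)) *
        ∑ w : ZMod (d * m), jacobiChar d (π (w - v)) * ZMod.stdAddChar (N := d * m) (γ * x * w) =
      m * ∑ y : ZMod d, jacobiChar d (m * y - η) * ∑ w : ZMod d, jacobiChar d (w - v) *
        ZMod.stdAddChar (N := d) (ZMod.unitsMap (dvd_mul_right d m) γ * y * w) := by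
    rw [sum_eq_sum_natCast_mul, Finset.mul_sum]
    · refine Finset.sum_congr rfl fun y _ ↦ ?_
      rw [hw]
      simp only [map_sub, map_mul, map_natCast, map_intCast, ZMod.natCast_zmod_val]
      ring
    · intro x hx
      have h := sum_periodic_mul_stdAddChar_eq_zero d m (fun w ↦ jacobiChar d (w - v))
        (a := γ * x) (by rwa [mul_assoc, ne_eq, Units.mul_right_eq_zero])
      simp only [map_sub, map_intCast]
      rw [h, mul_zero]
  simp only [hx]
  rw [← Finset.mul_sum, sum_comp_monoidHom_of_surjective (ZMod.unitsMap (dvd_mul_right d m))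
    (ZMod.unitsMap_surjective _) fun γ ↦ ∑ y : ZMod d, jacobiChar d (m * y - η) *
      ∑ w : ZMod d, jacobiChar d (w - v) * ZMod.stdAddChar (N := d) (γ * y * w), Finset.sum_comm]
  simp only [← Finset.mul_sum, sum_units_sum_sub_jacobiChar hsq hd, ZMod.card_units_eq_totient]
  have hfin := sum_sq_jacobiChar m (-η) hsq hodd
  rw [Int.cast_neg, jacobiChar_neg hd] at hfin
  rw [← hfin, Finset.mul_sum, Finset.mul_sum, Finset.mul_sum]
  refine Finset.sum_congr rfl fun y _ ↦ ?_
  push_cast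
  ring_nf

theorem statement1 (d c u v η : ℕ) (hd : 0 < d) (hdsq : Squarefree d) (hdmod : d % 4 = 1)
    (hc : 0 < c) (hu : 0 < u) (hv : 0 < v) (hη : 0 < η)
    (hrel : v * η * c ^ 2 = u * (Nat.lcm c d) ^ 2) (hdc : d ∣ c) :
    ∑ x ∈ Finset.range c, ∑ w ∈ Finset.range c,
      (jacobiSym (x : ℤ) d : ℂ) * (jacobiSym (w : ℤ) d : ℂ) *
        kloosterman ((x : ℤ) * (w : ℤ)) (u : ℤ) c *
        eC (((x * v + w * η : ℕ) : ℝ) / c)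
      = ((c * Nat.totient c : ℂ) / (Nat.totient d : ℂ)) * (jacobiSym (u : ℤ) d : ℂ) *
          (-1) ^ d.primeFactors.card *
          ∏ p ∈ d.primeFactors.filter (fun p => p ∣ c / d), ((1 : ℂ) - (p : ℂ)) := by
  rw [Nat.lcm_eq_left hdc] at hrel
  obtain rfl : v * η = u := Nat.eq_of_mul_eq_mul_right (by positivity) hrel
  obtain ⟨m, rfl⟩ := hdc
  have : NeZero d := ⟨hd.ne'⟩
  have : NeZero m := ⟨by rintro rfl; simp at hc⟩
  rw [Nat.mul_div_cancel_left m hd, Finset.prod_filter, mul_assoc _ ((-1 : ℂ) ^ _),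
    ← Finset.prod_const, ← Finset.prod_mul_distrib]
  have hmain := (sum_kloosterman_phase d (d * m) (dvd_mul_right d m) ((v : ℤ) : ZMod (d * m))
    ((η : ℤ) : ZMod (d * m))).trans (sum_kloosterman_phase_eq hdsq hdmod v η)
  simp only [jacobiChar_intCast] at hmain
  rw [Nat.cast_mul v η, jacobiSym.mul_left]
  have hfin : ((d * m : ℕ) : ℂ) * ((d * m).totient / d.totient) * (jacobiSym v d : ℂ) *
      ((jacobiSym η d : ℂ) * ∏ p ∈ d.primeFactors, (-1 * if p ∣ m then 1 - (p : ℂ) else 1)) =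
      (((d * m : ℕ) : ℂ) * ((d * m).totient : ℂ) / (d.totient : ℂ)) *
        ((jacobiSym v d * jacobiSym η d : ℤ) : ℂ) *
        ∏ p ∈ d.primeFactors, (-1 * if p ∣ m then 1 - (p : ℂ) else 1) := by
    push_cast
    ring
  rw [← hfin, ← hmain, ← sum_range_natCast]
  refine Finset.sum_congr rfl fun x _ ↦ ?_
  rw [← sum_range_natCast]
  refine Finset.sum_congr rfl fun w _ ↦ ?_
  rw [map_natCast (ZMod.castHom (dvd_mul_right d m) (ZMod d)),
    map_natCast (ZMod.castHom (dvd_mul_right d m) (ZMod d)), jacobiChar_natCast,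
    jacobiChar_natCast, kloosterman_eq_sum]
  have he := eC_intCast_div (d * m) ((x * v + w * η : ℕ) : ℤ)
  rw [Int.cast_natCast (R := ℝ)] at he
  rw [he]
  push_cast
  rfl
end

section
/- Let d be a positive odd squarefree integer and let w ∈ ℂ with Re(w) > 1. Then Σ_{c=1}^∞ (φ(c)/c^{1+w}) · (1/d) · ∏_{p prime, p ∣ gcd(c,d)} (−p) = (ζ(w)/ζ(1+w)) · ∏_{p prime, p ∣ d} ( (p^w − p) / ( p(p^w − 1) + p − 1 ) ), where ζ is the Riemann zeta function. -/
open scoped BigOperators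

/-- The product of `-p` over the primes `p` dividing both `c` and `d`. -/
noncomputable def negPrimeProd (d c : ℕ) : ℂ :=
  ∏ p ∈ (Nat.gcd c d).primeFactors, (-(p : ℂ))

/-- The coefficient `φ(c) / c ^ (1 + w)`, twisted by `negPrimeProd d`. -/
noncomputable def twistedTotientTerm (d : ℕ) (w : ℂ) (c : ℕ) : ℂ :=
  (Nat.totient c : ℂ) / (c : ℂ) ^ (1 + w) * negPrimeProd d c

lemma negPrimeProd_one (d : ℕ) : negPrimeProd d 1 = 1 := by
  simp [negPrimeProd]

lemma negPrimeProd_mul_of_coprime (d : ℕ) {m n : ℕ} (h : m.Coprime n) :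
    negPrimeProd d (m * n) = negPrimeProd d m * negPrimeProd d n := by
  have hcop : (m.gcd d).Coprime (n.gcd d) :=
    (h.coprime_dvd_left (Nat.gcd_dvd_left m d)).coprime_dvd_right (Nat.gcd_dvd_left n d)
  have hgcd : (m * n).gcd d = m.gcd d * n.gcd d := by
    rw [Nat.gcd_comm, h.gcd_mul, Nat.gcd_comm d, Nat.gcd_comm d]
  rw [negPrimeProd, hgcd, hcop.primeFactors_mul,
    Finset.prod_union hcop.disjoint_primeFactors, negPrimeProd, negPrimeProd]

lemma negPrimeProd_prime_pow_succ {d p : ℕ} (hd : d ≠ 0) (hp : p.Prime) (e : ℕ) :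
    negPrimeProd d (p ^ (e + 1)) = if p ∣ d then -(p : ℂ) else 1 := by
  rw [negPrimeProd, Nat.primeFactors_gcd (pow_ne_zero _ hp.ne_zero) hd,
    Nat.primeFactors_prime_pow e.succ_ne_zero hp]
  split_ifs with h
  · rw [Finset.inter_eq_left.mpr (by simp [hp, h, hd]), Finset.prod_singleton]
  · rw [Finset.singleton_inter_of_notMem (by simp [h]), Finset.prod_empty]

lemma norm_negPrimeProd_le {d : ℕ} (hd : 0 < d) (c : ℕ) : ‖negPrimeProd d c‖ ≤ d := by
  have hle : ∏ p ∈ (c.gcd d).primeFactors, p ≤ d :=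
    Nat.le_of_dvd hd ((Nat.prod_primeFactors_dvd _).trans (Nat.gcd_dvd_right c d))
  simpa [negPrimeProd, norm_prod] using (Nat.cast_le (α := ℝ)).mpr hle

lemma twistedTotientTerm_zero (d : ℕ) (w : ℂ) : twistedTotientTerm d w 0 = 0 := by
  simp [twistedTotientTerm]

lemma twistedTotientTerm_one (d : ℕ) (w : ℂ) : twistedTotientTerm d w 1 = 1 := by
  simp [twistedTotientTerm, negPrimeProd_one]

lemma twistedTotientTerm_mul_of_coprime (d : ℕ) (w : ℂ) {m n : ℕ} (h : m.Coprime n) :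
    twistedTotientTerm d w (m * n) = twistedTotientTerm d w m * twistedTotientTerm d w n := by
  simp only [twistedTotientTerm, negPrimeProd_mul_of_coprime d h, Nat.totient_mul h,
    Nat.cast_mul, Complex.natCast_mul_natCast_cpow]
  ring

lemma summable_norm_twistedTotientTerm {d : ℕ} (hd : 0 < d) {w : ℂ} (hw : 1 < w.re) :
    Summable (‖twistedTotientTerm d w ·‖) := by
  refine Summable.of_nonneg_of_le (fun _ ↦ norm_nonneg _) (fun c ↦ ?_)
    ((Real.summable_nat_rpow_inv.mpr hw).mul_right (d : ℝ))
  rcases c.eq_zero_or_pos with rfl | hc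
  · rw [twistedTotientTerm_zero, norm_zero]
    positivity
  rw [twistedTotientTerm, norm_mul]
  gcongr
  · have hc' : (0 : ℝ) < c := mod_cast hc
    rw [norm_div, Complex.norm_natCast, Complex.norm_natCast_cpow_of_pos hc, Complex.add_re,
      Complex.one_re, Real.rpow_add hc', Real.rpow_one, div_le_iff₀ (by positivity),
      mul_comm (c : ℝ), inv_mul_cancel_left₀ (by positivity)]
    exact_mod_cast c.totient_le
  · exact norm_negPrimeProd_le hd c

lemma twistedTotientTerm_prime_pow_succ {d p : ℕ} (hd : d ≠ 0) (hp : p.Prime) (w : ℂ) (e : ℕ) :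
    twistedTotientTerm d w (p ^ (e + 1)) =
      (1 - (p : ℂ)⁻¹) * (if p ∣ d then -(p : ℂ) else 1) * (p : ℂ) ^ (-w) *
        ((p : ℂ) ^ (-w)) ^ e := by
  have hp0 : (p : ℂ) ≠ 0 := mod_cast hp.ne_zero
  have hpw : (p : ℂ) ^ w ≠ 0 := by simp [Complex.cpow_eq_zero_iff, hp0]
  rw [twistedTotientTerm, negPrimeProd_prime_pow_succ hd hp, Nat.totient_prime_pow_succ hp,
    Nat.cast_pow, ← Complex.natCast_cpow_natCast_mul, mul_comm ((e + 1 : ℕ) : ℂ),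
    Complex.cpow_mul_nat, Complex.cpow_add _ _ hp0, Complex.cpow_one, Complex.cpow_neg]
  push_cast [hp.one_le]
  rw [inv_pow, mul_pow]
  field_simp
  ring

lemma tsum_twistedTotientTerm_prime_pow {d p : ℕ} (hd : 0 < d) (hp : p.Prime) {w : ℂ}
    (hw : 1 < w.re) :
    ∑' e, twistedTotientTerm d w (p ^ e) =
      1 + (1 - (p : ℂ)⁻¹) * (if p ∣ d then -(p : ℂ) else 1) * (p : ℂ) ^ (-w) *
        (1 - (p : ℂ) ^ (-w))⁻¹ := by
  have hsum : Summable fun e ↦ twistedTotientTerm d w (p ^ e) :=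
    (summable_norm_twistedTotientTerm hd hw).of_norm.comp_injective
      (Nat.pow_right_injective hp.two_le)
  rw [hsum.tsum_eq_zero_add, pow_zero, twistedTotientTerm_one]
  simp only [twistedTotientTerm_prime_pow_succ hd.ne' hp]
  rw [tsum_mul_left, tsum_geometric_of_norm_lt_one]
  exact Complex.norm_prime_cpow_le_one_half ⟨p, hp⟩ hw |>.trans_lt (by norm_num)

/-- The local factor at a prime of the totient series, compared with those of the zeta function. -/
lemma tsum_twistedTotientTerm_prime_pow_mul {d p : ℕ} (hd : 0 < d) (hp : p.Prime) {w : ℂ}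
    (hw : 1 < w.re) :
    (∑' e, twistedTotientTerm d w (p ^ e)) * (1 - (p : ℂ) ^ (-(1 + w)))⁻¹ =
      (1 - (p : ℂ) ^ (-w))⁻¹ * if p ∣ d then (p : ℂ) *
        (((p : ℂ) ^ w - (p : ℂ)) / ((p : ℂ) * ((p : ℂ) ^ w - 1) + (p : ℂ) - 1)) else 1 := by
  have hp0 : (p : ℂ) ≠ 0 := mod_cast hp.ne_zero
  have hpw : (p : ℂ) ^ w ≠ 0 := by simp [Complex.cpow_eq_zero_iff, hp0]
  have hne (s : ℂ) (hs : 1 < s.re) : 1 - (p : ℂ) ^ (-s) ≠ 0 := fun h ↦ by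
    have := Complex.norm_prime_cpow_le_one_half ⟨p, hp⟩ hs
    rw [← sub_eq_zero.mp h, norm_one] at this
    norm_num at this
  have h1 := hne w hw
  have h2 := hne (1 + w) (by rw [Complex.add_re, Complex.one_re]; linarith)
  rw [tsum_twistedTotientTerm_prime_pow hd hp hw]
  have hadd : (p : ℂ) ^ (-(1 + w)) = ((p : ℂ) * (p : ℂ) ^ w)⁻¹ := by
    rw [Complex.cpow_neg, Complex.cpow_add _ _ hp0, Complex.cpow_one]
  rw [hadd] at h2 ⊢
  rw [Complex.cpow_neg] at h1 ⊢
  generalize (p : ℂ) ^ w = y at *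
  have h1' : y - 1 ≠ 0 := fun h ↦ h1 (by rw [sub_eq_zero.mp h]; simp)
  have h2' : (p : ℂ) * y - 1 ≠ 0 := fun h ↦ h2 (by rw [sub_eq_zero.mp h]; simp)
  have h3 : (p : ℂ) * (y - 1) + p - 1 ≠ 0 := by convert h2' using 1; ring
  have h4 : (p : ℂ) * (y - 1) + p - 1 = p * y - 1 := by ring
  rw [h4]
  split_ifs
  · field_simp
    ring
  · field_simp
    ring

lemma hasProd_primes_ite_dvd {d : ℕ} (hd : d ≠ 0) (g : ℕ → ℂ) :
    HasProd (fun p : Nat.Primes ↦ if (p : ℕ) ∣ d then g p else 1) (∏ p ∈ d.primeFactors, g p) := by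
  have h : ∏ p ∈ d.primeFactors.subtype Nat.Prime, (if (p : ℕ) ∣ d then g p else 1) =
      ∏ p ∈ d.primeFactors, g p := by
    rw [← Finset.prod_subtype_of_mem (fun p ↦ g p) (fun _ ↦ Nat.prime_of_mem_primeFactors)]
    refine Finset.prod_congr rfl fun p hp ↦ if_pos ?_
    exact Nat.dvd_of_mem_primeFactors (Finset.mem_subtype.mp hp)
  rw [← h]
  refine hasProd_prod_of_ne_finset_one fun p hp ↦ if_neg fun hpd ↦ hp ?_
  exact Finset.mem_subtype.mpr (Nat.mem_primeFactors.mpr ⟨p.prop, hpd, hd⟩)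

lemma tsum_twistedTotientTerm_mul_riemannZeta {d : ℕ} (hd : 0 < d) {w : ℂ} (hw : 1 < w.re) :
    (∑' c, twistedTotientTerm d w c) * riemannZeta (1 + w) =
      riemannZeta w * ∏ p ∈ d.primeFactors, (p : ℂ) *
        (((p : ℂ) ^ w - (p : ℂ)) / ((p : ℂ) * ((p : ℂ) ^ w - 1) + (p : ℂ) - 1)) := by
  have hw' : 1 < (1 + w).re := by rw [Complex.add_re, Complex.one_re]; linarith
  have hL := (EulerProduct.eulerProduct_hasProd (twistedTotientTerm_one d w)
    (twistedTotientTerm_mul_of_coprime d w) (summable_norm_twistedTotientTerm hd hw)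
    (twistedTotientTerm_zero d w)).mul (riemannZeta_eulerProduct_hasProd hw')
  have hR := (riemannZeta_eulerProduct_hasProd hw).mul (hasProd_primes_ite_dvd hd.ne' fun p ↦
    (p : ℂ) * (((p : ℂ) ^ w - (p : ℂ)) / ((p : ℂ) * ((p : ℂ) ^ w - 1) + (p : ℂ) - 1)))
  refine hL.unique ?_
  convert hR using 2 with p
  exact tsum_twistedTotientTerm_prime_pow_mul hd p.prop hw

/- The `c = 0` term of the series below vanishes (`φ(0) = 0`), so the `∑'` over all of `ℕ`
is the series `Σ_{c ≥ 1}`. -/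
theorem statement3 (d : ℕ) (hd : 0 < d) (hodd : Odd d) (hdsq : Squarefree d)
    (w : ℂ) (hw : 1 < w.re) :
    ∑' c : ℕ, ((Nat.totient c : ℂ) / (c : ℂ) ^ (1 + w)) * (1 / (d : ℂ)) *
        ∏ p ∈ (Nat.gcd c d).primeFactors, (-(p : ℂ))
      = (riemannZeta w / riemannZeta (1 + w)) *
        ∏ p ∈ d.primeFactors,
          (((p : ℂ) ^ w - (p : ℂ)) / ((p : ℂ) * ((p : ℂ) ^ w - 1) + (p : ℂ) - 1)) := by
  have hw' : 1 < (1 + w).re := by rw [Complex.add_re, Complex.one_re]; linarith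
  have hζ : riemannZeta (1 + w) ≠ 0 := riemannZeta_ne_zero_of_one_lt_re hw'
  have hd0 : (d : ℂ) ≠ 0 := mod_cast hd.ne'
  have hprod : ∏ p ∈ d.primeFactors, (p : ℂ) = d := by
    rw [← Nat.cast_prod, Nat.prod_primeFactors_of_squarefree hdsq]
  have key := tsum_twistedTotientTerm_mul_riemannZeta hd hw
  rw [Finset.prod_mul_distrib, hprod] at key
  have hterm (c : ℕ) : ((Nat.totient c : ℂ) / (c : ℂ) ^ (1 + w)) * (1 / (d : ℂ)) *
      ∏ p ∈ (Nat.gcd c d).primeFactors, (-(p : ℂ)) = 1 / (d : ℂ) * twistedTotientTerm d w c := by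
    rw [twistedTotientTerm, negPrimeProd]
    ring
  simp only [hterm]
  rw [tsum_mul_left, eq_div_of_mul_eq hζ key]
  field_simp
end

section
/- There exists an absolute constant C > 0 such that for every integer k ≥ 2 and every s ∈ ℂ with Re(s) ≥ −k/2, there exist complex numbers R and F with |R| ≤ C·|s|²/k and |F| ≤ C/k such that Γ(s+k)/Γ(k) = k^s · e^R · (1 + F), where k^s = exp(s·log k) with the real logarithm of the positive integer k, and Γ is the complex Gamma function. -/
open Filter Topology

/-- The quadratic remainder `z - log (1 + z)` of the principal logarithm. -/
noncomputable def logRemainder (z : ℂ) : ℂ := z - Complex.log (1 + z)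

lemma norm_logRemainder_le {z : ℂ} (hz : -(1 / 2) ≤ z.re) :
    ‖logRemainder z‖ ≤ 24 * ‖z‖ ^ 2 := by
  unfold logRemainder
  rcases le_total ‖z‖ (1 / 2) with h | h
  · have h1 := Complex.norm_log_one_add_sub_self_le (z := z) (by linarith)
    have h2 : (1 - ‖z‖)⁻¹ ≤ 2 := by
      rw [inv_le_comm₀ (by linarith) (by norm_num)]
      linarith
    rw [norm_sub_rev]
    nlinarith [mul_le_mul_of_nonneg_left h2 (sq_nonneg ‖z‖), sq_nonneg ‖z‖]
  · have hre : 1 / 2 ≤ ‖1 + z‖ := by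
      have h1 := Complex.re_le_norm (1 + z)
      simp only [Complex.add_re, Complex.one_re] at h1
      linarith
    have hpos : 0 < ‖1 + z‖ := by linarith
    have hup : Real.log ‖1 + z‖ ≤ ‖z‖ := by
      have h1 := Real.log_le_sub_one_of_pos hpos
      have h2 := norm_add_le (1 : ℂ) z
      rw [norm_one] at h2
      linarith
    have hlow : -1 ≤ Real.log ‖1 + z‖ := by
      have h1 := Real.one_sub_inv_le_log_of_pos hpos
      have h2 : ‖1 + z‖⁻¹ ≤ 2 := by
        rw [inv_le_comm₀ hpos (by norm_num)]
        linarith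
      linarith
    have habs : |Real.log ‖1 + z‖| ≤ 1 + ‖z‖ :=
      abs_le.2 ⟨by linarith [norm_nonneg z], by linarith⟩
    have hlog : ‖Complex.log (1 + z)‖ ≤ 1 + ‖z‖ + 4 := by
      refine (Complex.norm_le_abs_re_add_abs_im _).trans ?_
      rw [Complex.log_re, Complex.log_im]
      have := Complex.abs_arg_le_pi (1 + z)
      linarith [Real.pi_le_four]
    have := norm_sub_le z (Complex.log (1 + z))
    nlinarith

lemma sum_inv_add_sq_le {k : ℕ} (hk : 2 ≤ k) (n : ℕ) :
    ∑ j ∈ Finset.range n, (((k : ℝ) + j) ^ 2)⁻¹ ≤ 2 / k := by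
  have hk' : (2 : ℝ) ≤ k := by exact_mod_cast hk
  have key : ∑ j ∈ Finset.range n, (((k : ℝ) + j) ^ 2)⁻¹ ≤
      1 / ((k : ℝ) - 1) - 1 / ((k : ℝ) + n - 1) := by
    induction n with
    | zero => simp
    | succ n ih =>
      have hn : (0 : ℝ) ≤ n := n.cast_nonneg
      have h0 : (0 : ℝ) < k + n - 1 := by linarith
      have h1 : (0 : ℝ) < k + n := by linarith
      have : (((k : ℝ) + n) ^ 2)⁻¹ ≤ 1 / ((k : ℝ) + n - 1) - 1 / ((k : ℝ) + n) := by
        rw [div_sub_div _ _ h0.ne' h1.ne', inv_eq_one_div, div_le_div_iff₀ (by positivity)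
          (by positivity)]
        nlinarith
      rw [Finset.sum_range_succ]
      push_cast
      rw [show (k : ℝ) + (n + 1) - 1 = k + n by ring]
      linarith
  have h2 : 1 / ((k : ℝ) - 1) ≤ 2 / k := by
    rw [div_le_div_iff₀ (by linarith) (by linarith)]
    linarith
  have h3 : 0 ≤ 1 / ((k : ℝ) + n - 1) := by
    have hn : (0 : ℝ) ≤ n := n.cast_nonneg
    apply div_nonneg <;> linarith
  linarith

lemma neg_half_le_re_div {k : ℕ} (hk : 2 ≤ k) {s : ℂ} (hs : -(k : ℝ) / 2 ≤ s.re) (j : ℕ) :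
    -(1 / 2) ≤ (s / ((k : ℂ) + j)).re := by
  have hk' : (2 : ℝ) ≤ k := by exact_mod_cast hk
  have hj : (0 : ℝ) ≤ j := j.cast_nonneg
  rw [show (k : ℂ) + j = (((k : ℝ) + j : ℝ) : ℂ) by push_cast; rfl, Complex.div_ofReal_re,
    le_div_iff₀ (by linarith)]
  linarith

lemma norm_logRemainder_div_le {k : ℕ} (hk : 2 ≤ k) {s : ℂ} (hs : -(k : ℝ) / 2 ≤ s.re) (j : ℕ) :
    ‖logRemainder (s / ((k : ℂ) + j))‖ ≤ 24 * ‖s‖ ^ 2 * (((k : ℝ) + j) ^ 2)⁻¹ := by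
  refine (norm_logRemainder_le (neg_half_le_re_div hk hs j)).trans_eq ?_
  rw [norm_div, show (k : ℂ) + j = ((k + j : ℕ) : ℂ) by push_cast; rfl, Complex.norm_natCast]
  push_cast
  rw [div_pow, div_eq_mul_inv, mul_assoc]

lemma summable_inv_add_sq {k : ℕ} (hk : 2 ≤ k) :
    Summable fun j : ℕ ↦ (((k : ℝ) + j) ^ 2)⁻¹ :=
  summable_of_sum_range_le (fun _ ↦ by positivity) (sum_inv_add_sq_le hk)

lemma summable_logRemainder_div {k : ℕ} (hk : 2 ≤ k) {s : ℂ} (hs : -(k : ℝ) / 2 ≤ s.re) :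
    Summable fun j : ℕ ↦ logRemainder (s / ((k : ℂ) + j)) :=
  .of_norm_bounded ((summable_inv_add_sq hk).mul_left _) (norm_logRemainder_div_le hk hs)

lemma norm_tsum_logRemainder_div_le {k : ℕ} (hk : 2 ≤ k) {s : ℂ} (hs : -(k : ℝ) / 2 ≤ s.re) :
    ‖∑' j : ℕ, logRemainder (s / ((k : ℂ) + j))‖ ≤ 48 * ‖s‖ ^ 2 / k := by
  refine (tsum_of_norm_bounded ((summable_inv_add_sq hk).mul_left _).hasSum
    (norm_logRemainder_div_le hk hs)).trans ?_
  rw [tsum_mul_left]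
  have h := Real.tsum_le_of_sum_range_le (fun _ ↦ by positivity) (sum_inv_add_sq_le hk)
  calc _ ≤ 24 * ‖s‖ ^ 2 * (2 / (k : ℝ)) := by gcongr
    _ = _ := by ring

lemma sum_log_one_add_inv {k : ℕ} (hk : 2 ≤ k) (n : ℕ) :
    ∑ j ∈ Finset.range n, Complex.log (1 + 1 / ((k : ℂ) + j)) =
      (Real.log (k + n) : ℂ) - (Real.log k : ℂ) := by
  have hk' : (0 : ℝ) < k := by positivity
  induction n with
  | zero => simp
  | succ n ih =>
    have h1 : (0 : ℝ) < (k : ℝ) + n := by positivity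
    have h2 : (0 : ℝ) < (k : ℝ) + (n + 1) := by positivity
    have h : Complex.log (1 + 1 / ((k : ℂ) + n)) =
        (Real.log ((k : ℝ) + (n + 1)) : ℂ) - (Real.log ((k : ℝ) + n) : ℂ) := by
      rw [← Complex.ofReal_sub, ← Real.log_div h2.ne' h1.ne', Complex.ofReal_log (by positivity)]
      congr 1
      have h3 : (k : ℂ) + n ≠ 0 := by exact_mod_cast h1.ne'
      push_cast
      field_simp
      ring
    rw [Finset.sum_range_succ, ih, h]
    push_cast
    ring

lemma GammaSeq_add_div_GammaSeq {k : ℕ} (hk : 2 ≤ k) {s : ℂ} (hs : -(k : ℝ) / 2 ≤ s.re)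
    {n : ℕ} (hn : n ≠ 0) :
    Complex.GammaSeq (s + k) n / Complex.GammaSeq k n =
      Complex.exp (s * (Real.log k : ℂ) + s * (Real.log (n / (k + (n + 1))) : ℂ)
        - s * ∑ j ∈ Finset.range (n + 1), logRemainder (1 / ((k : ℂ) + j))
        + ∑ j ∈ Finset.range (n + 1), logRemainder (s / ((k : ℂ) + j))) := by
  have hn0 : (n : ℂ) ≠ 0 := by exact_mod_cast hn
  have hk0 : ∀ j : ℕ, (k : ℂ) + j ≠ 0 := fun j ↦ by
    have : k + j ≠ 0 := by omega
    exact_mod_cast this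
  have hs0 : ∀ j : ℕ, 1 + s / ((k : ℂ) + j) ≠ 0 := fun j h ↦ by
    have h1 := neg_half_le_re_div hk hs j
    have h2 := congrArg Complex.re h
    simp only [Complex.add_re, Complex.one_re, Complex.zero_re] at h2
    linarith
  have hprod : ∏ j ∈ Finset.range (n + 1), (s + k + j) =
      (∏ j ∈ Finset.range (n + 1), ((k : ℂ) + j)) *
        Complex.exp (∑ j ∈ Finset.range (n + 1), Complex.log (1 + s / ((k : ℂ) + j))) := by
    rw [Complex.exp_sum, ← Finset.prod_mul_distrib]
    refine Finset.prod_congr rfl fun j _ ↦ ?_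
    rw [Complex.exp_log (hs0 j), mul_add, mul_div_cancel₀ _ (hk0 j)]
    ring
  have hP : ∏ j ∈ Finset.range (n + 1), ((k : ℂ) + j) ≠ 0 :=
    Finset.prod_ne_zero_iff.2 fun j _ ↦ hk0 j
  have hfac : (n.factorial : ℂ) ≠ 0 := by exact_mod_cast n.factorial_ne_zero
  have hexp : s * (Real.log k : ℂ) + s * (Real.log (n / (k + (n + 1))) : ℂ)
        - s * ∑ j ∈ Finset.range (n + 1), logRemainder (1 / ((k : ℂ) + j))
        + ∑ j ∈ Finset.range (n + 1), logRemainder (s / ((k : ℂ) + j)) =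
      s * (Real.log n : ℂ) -
        ∑ j ∈ Finset.range (n + 1), Complex.log (1 + s / ((k : ℂ) + j)) := by
    have h1 := sum_log_one_add_inv hk (n + 1)
    have h2 : ∑ j ∈ Finset.range (n + 1), s / ((k : ℂ) + j) =
        s * ∑ j ∈ Finset.range (n + 1), 1 / ((k : ℂ) + j) := by
      simp only [Finset.mul_sum, mul_one_div]
    simp only [logRemainder, Finset.sum_sub_distrib]
    rw [h1, h2, Real.log_div (by exact_mod_cast hn) (by positivity)]
    push_cast
    ring
  rw [hexp, Complex.GammaSeq, Complex.GammaSeq, hprod, Complex.cpow_add _ _ hn0, Complex.exp_sub,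
    Complex.cpow_def_of_ne_zero hn0 s, ← Complex.natCast_log, mul_comm s]
  have hc : (n : ℂ) ^ (k : ℂ) ≠ 0 := by simp [hn0]
  have he := Complex.exp_ne_zero (∑ j ∈ Finset.range (n + 1), Complex.log (1 + s / ((k : ℂ) + j)))
  field_simp

lemma Gamma_add_natCast_div_Gamma {k : ℕ} (hk : 2 ≤ k) {s : ℂ} (hs : -(k : ℝ) / 2 ≤ s.re) :
    Complex.Gamma (s + k) / Complex.Gamma k =
      Complex.exp (s * (Real.log k : ℂ)
        - s * ∑' j : ℕ, logRemainder (1 / ((k : ℂ) + j))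
        + ∑' j : ℕ, logRemainder (s / ((k : ℂ) + j))) := by
  have hk' : (2 : ℝ) ≤ k := by exact_mod_cast hk
  have hG : Complex.Gamma k ≠ 0 :=
    Complex.Gamma_ne_zero_of_re_pos (by rw [Complex.natCast_re]; linarith)
  have hlim := (Complex.GammaSeq_tendsto_Gamma (s + k)).div
    (Complex.GammaSeq_tendsto_Gamma k) hG
  have hone : -(k : ℝ) / 2 ≤ (1 : ℂ).re := by rw [Complex.one_re]; linarith
  have hsum {z : ℂ} (hz : -(k : ℝ) / 2 ≤ z.re) :=
    ((summable_logRemainder_div hk hz).hasSum.tendsto_sum_nat).comp (tendsto_add_atTop_nat 1)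
  have hlog : Tendsto (fun n : ℕ ↦ ((Real.log (n / (k + (n + 1))) : ℝ) : ℂ)) atTop (𝓝 0) := by
    have h1 : Tendsto (fun n : ℕ ↦ (n : ℝ) / (n + (k + 1))) atTop (𝓝 1) :=
      tendsto_natCast_div_add_atTop ((k : ℝ) + 1)
    have h2 := (Complex.continuous_ofReal.tendsto _).comp (h1.log one_ne_zero)
    rw [Real.log_one, Complex.ofReal_zero] at h2
    refine h2.congr fun n ↦ ?_
    simp only [Function.comp_apply]
    congr 3
    ring
  have hexp := (((tendsto_const_nhds (x := s * (Real.log k : ℂ))).add (hlog.const_mul s)).sub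
    ((hsum hone).const_mul s)).add (hsum hs)
  rw [mul_zero, add_zero] at hexp
  refine tendsto_nhds_unique hlim (((Complex.continuous_exp.tendsto _).comp hexp).congr' ?_)
  filter_upwards [eventually_ne_atTop 0] with n hn
  simpa using (GammaSeq_add_div_GammaSeq hk hs hn).symm

theorem statement5 :
    ∃ C : ℝ, 0 < C ∧
      ∀ k : ℕ, 2 ≤ k → ∀ s : ℂ, -(k : ℝ) / 2 ≤ s.re →
        ∃ R F : ℂ, ‖R‖ ≤ C * ‖s‖ ^ 2 / k ∧ ‖F‖ ≤ C / k ∧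
          Complex.Gamma (s + (k : ℂ)) / Complex.Gamma (k : ℂ)
            = Complex.exp (s * (Real.log k : ℂ)) * Complex.exp R * (1 + F) := by
  refine ⟨96 * Real.exp 24, by positivity, fun k hk s hs ↦ ?_⟩
  have hk' : (2 : ℝ) ≤ k := by exact_mod_cast hk
  have hC : 1 ≤ Real.exp 24 := Real.one_le_exp (by norm_num)
  have hone : -(k : ℝ) / 2 ≤ (1 : ℂ).re := by rw [Complex.one_re]; linarith
  have hE := norm_tsum_logRemainder_div_le hk hone
  have hG := norm_tsum_logRemainder_div_le hk hs
  rw [norm_one, one_pow, mul_one] at hE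
  rw [Gamma_add_natCast_div_Gamma hk hs]
  set E := ∑' j : ℕ, logRemainder (1 / ((k : ℂ) + j))
  set G := ∑' j : ℕ, logRemainder (s / ((k : ℂ) + j))
  rcases le_total 1 ‖s‖ with h | h
  · refine ⟨-(s * E) + G, 0, ?_, by rw [norm_zero]; positivity, ?_⟩
    · calc ‖-(s * E) + G‖ ≤ ‖s‖ * ‖E‖ + ‖G‖ := by
            simpa only [norm_neg, norm_mul] using norm_add_le (-(s * E)) G
        _ ≤ ‖s‖ ^ 2 * (48 / k) + 48 * ‖s‖ ^ 2 / k := by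
            gcongr
            nlinarith
        _ = 96 * 1 * ‖s‖ ^ 2 / k := by ring
        _ ≤ _ := by gcongr
    · rw [add_zero, mul_one, ← Complex.exp_add]
      ring_nf
  · refine ⟨G, Complex.exp (-(s * E)) - 1, hG.trans ?_, ?_, ?_⟩
    · gcongr
      linarith
    · have hsE : ‖-(s * E)‖ ≤ 48 / k := by
        rw [norm_neg, norm_mul]
        exact (mul_le_of_le_one_left (norm_nonneg _) h).trans hE
      have h24 : (48 : ℝ) / k ≤ 24 := by
        rw [div_le_iff₀ (by linarith)]
        linarith
      have hexp := Complex.norm_exp_sub_sum_le_norm_mul_exp (-(s * E)) 1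
      simp only [Finset.sum_range_one, pow_zero, Nat.factorial_zero, Nat.cast_one, div_one,
        pow_one] at hexp
      calc _ ≤ _ := hexp
        _ ≤ 48 / k * Real.exp 24 := by
            gcongr
            exact hsE.trans h24
        _ = 48 * Real.exp 24 / k := by ring
        _ ≤ _ := by gcongr; norm_num
    · rw [add_sub_cancel, ← Complex.exp_add, ← Complex.exp_add]
      ring_nf
end

section
/- For every real A ≥ 1 there exists a constant C = C(A) > 0 such that for every integer k ≥ 2 and every real ξ > 0, one has |V_k(ξ)| ≤ C · (k/ξ)^A. -/
/-- `V_k(x) = (1/(2π)) ∫_ℝ (2π)^{-(1+it)} (Γ(1+it+k)/Γ(k)) x^{-(1+it)} e^{(1+it)²} (1+it)⁻¹ dt`. -/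
noncomputable def Vk (k : ℕ) (x : ℝ) : ℂ :=
  ((1 / (2 * Real.pi) : ℝ) : ℂ) *
    ∫ t : ℝ,
      ((2 * Real.pi : ℝ) : ℂ) ^ (-(1 + (t : ℂ) * Complex.I)) *
        (Complex.Gamma (1 + (t : ℂ) * Complex.I + (k : ℂ)) / Complex.Gamma (k : ℂ)) *
        (x : ℂ) ^ (-(1 + (t : ℂ) * Complex.I)) *
        Complex.exp ((1 + (t : ℂ) * Complex.I) ^ 2) / (1 + (t : ℂ) * Complex.I)

open MeasureTheory Filter Topology

/-- Shifting the line of integration of a function which is holomorphic on a vertical strip and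
decays uniformly there. -/
theorem integral_vertical_line_eq {f : ℂ → ℂ} {a b : ℝ} {g : ℝ → ℝ} (hab : a ≤ b)
    (hf : DifferentiableOn ℂ f {s | s.re ∈ Set.Icc a b})
    (hg : Integrable g) (hg_top : Tendsto g atTop (𝓝 0)) (hg_bot : Tendsto g atBot (𝓝 0))
    (hfg : ∀ s : ℂ, s.re ∈ Set.Icc a b → ‖f s‖ ≤ g s.im) :
    ∫ t : ℝ, f (a + t * Complex.I) = ∫ t : ℝ, f (b + t * Complex.I) := by
  have integrable_line (c : ℝ) (hc : c ∈ Set.Icc a b) :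
      Integrable fun t : ℝ => f (c + t * Complex.I) := by
    refine hg.mono' (Continuous.aestronglyMeasurable ?_) (.of_forall fun t => ?_)
    · exact hf.continuousOn.comp_continuous (by fun_prop) fun t => by simpa using hc
    · simpa using hfg (c + t * Complex.I) (by simpa using hc)
  have horizontal (u : ℝ → ℝ) (hu : Tendsto (fun T => g (u T)) atTop (𝓝 0)) :
      Tendsto (fun T : ℝ => ∫ x in a..b, f (x + u T * Complex.I)) atTop (𝓝 0) := by
    refine squeeze_zero_norm (a := fun T => g (u T) * |b - a|) (fun T => ?_)
      (by simpa using hu.mul_const _)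
    refine intervalIntegral.norm_integral_le_of_norm_le_const fun x hx => ?_
    rw [Set.uIoc_of_le hab] at hx
    simpa using hfg (x + u T * Complex.I) (by simpa using ⟨hx.1.le, hx.2⟩)
  have vertical (c : ℝ) (hc : c ∈ Set.Icc a b) :=
    intervalIntegral_tendsto_integral (integrable_line c hc) tendsto_neg_atTop_atBot tendsto_id
  have rectangle (T : ℝ) :
      (∫ x in a..b, f (x + (-T : ℝ) * Complex.I)) - (∫ x in a..b, f (x + T * Complex.I)) +
        Complex.I * (∫ y in (-T)..T, f (b + y * Complex.I)) -
        Complex.I * (∫ y in (-T)..T, f (a + y * Complex.I)) = 0 := by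
    have := Complex.integral_boundary_rect_eq_zero_of_differentiableOn f ⟨a, -T⟩ ⟨b, T⟩
      (hf.mono fun s hs => by
        have := hs.1
        rwa [Set.uIcc_of_le hab] at this)
    simpa using this
  have limit := (((horizontal _ (hg_bot.comp tendsto_neg_atTop_atBot)).sub
    (horizontal id hg_top)).add
      ((vertical b (Set.right_mem_Icc.2 hab)).const_mul Complex.I)).sub
      ((vertical a (Set.left_mem_Icc.2 hab)).const_mul Complex.I)
  have := tendsto_nhds_unique (limit.congr rectangle) tendsto_const_nhds
  rw [sub_zero, zero_add, ← mul_sub, mul_eq_zero, sub_eq_zero] at this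
  exact (this.resolve_left Complex.I_ne_zero).symm

theorem Real.Gamma_add_natCast_le {x : ℝ} (hx : 0 < x) (m : ℕ) :
    Real.Gamma (x + m) ≤ Real.Gamma x * (x + m) ^ m := by
  induction m with
  | zero => simp
  | succ m ih =>
    have hΓ := Real.Gamma_pos_of_pos hx
    push_cast
    rw [← add_assoc, Real.Gamma_add_one (by positivity), pow_succ]
    have h_le : x + m ≤ x + m + 1 := by linarith
    have h_pow : (x + m) ^ m ≤ (x + m + 1) ^ m := pow_le_pow_left₀ (by positivity) h_le m
    calc (x + m) * Real.Gamma (x + m)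
        ≤ (x + m + 1) * (Real.Gamma x * (x + m + 1) ^ m) := by
          gcongr
          exact ih.trans (by gcongr)
      _ = _ := by ring

theorem Real.Gamma_add_le {x a : ℝ} {m : ℕ} (hx : 0 < x) (ha : 0 < a) (ham : a < m) :
    Real.Gamma (x + a) ≤ Real.Gamma x * (x + m) ^ a := by
  have hm : (0 : ℝ) < m := ha.trans ham
  have hΓ := Real.Gamma_pos_of_pos hx
  have hθ : 0 < 1 - a / m := sub_pos.2 ((div_lt_one hm).2 ham)
  calc Real.Gamma (x + a)
      = Real.Gamma ((1 - a / m) * x + a / m * (x + m)) := by congr 1; field_simp; ring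
    _ ≤ Real.Gamma x ^ (1 - a / m) * Real.Gamma (x + m) ^ (a / m) :=
      Real.Gamma_mul_add_mul_le_rpow_Gamma_mul_rpow_Gamma hx (by positivity) hθ
        (by positivity) (by ring)
    _ ≤ Real.Gamma x ^ (1 - a / m) * (Real.Gamma x * (x + m) ^ m) ^ (a / m) := by
      gcongr
      exact Real.Gamma_add_natCast_le hx m
    _ = Real.Gamma x * (x + m) ^ a := by
      rw [Real.mul_rpow hΓ.le (by positivity), ← mul_assoc, ← Real.rpow_add hΓ,
        ← Real.rpow_natCast, ← Real.rpow_mul (by positivity), mul_div_cancel₀ _ hm.ne']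
      simp

theorem Complex.norm_Gamma_le {s : ℂ} (hs : 0 < s.re) : ‖Complex.Gamma s‖ ≤ Real.Gamma s.re := by
  rw [Complex.Gamma_eq_integral hs, Real.Gamma_eq_integral hs]
  refine norm_integral_le_of_norm_le (Real.GammaIntegral_convergent hs) ?_
  filter_upwards [ae_restrict_mem measurableSet_Ioi] with x hx
  rw [norm_mul, Complex.norm_of_nonneg (Real.exp_pos _).le,
    Complex.norm_cpow_eq_rpow_re_of_pos hx]
  simp

/-- The integrand of `Vk` as a function of a complex variable. -/
noncomputable def VkIntegrand (k : ℕ) (x : ℝ) (s : ℂ) : ℂ :=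
  ((2 * Real.pi : ℝ) : ℂ) ^ (-s) * (Complex.Gamma (s + k) / Complex.Gamma k) *
    (x : ℂ) ^ (-s) * Complex.exp (s ^ 2) / s

theorem differentiableAt_VkIntegrand (k : ℕ) {x : ℝ} (hx : 0 < x) {s : ℂ} (hs : 0 < s.re) :
    DifferentiableAt ℂ (VkIntegrand k x) s := by
  have h_gamma : DifferentiableAt ℂ (fun s : ℂ => Complex.Gamma (s + k)) s := by
    refine DifferentiableAt.comp s (Complex.differentiableAt_Gamma _ fun m h => ?_) (by fun_prop)
    have h_re : s.re + k = -m := by simpa using congrArg Complex.re h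
    have : (0 : ℝ) ≤ k := by positivity
    have : (0 : ℝ) ≤ m := by positivity
    linarith
  have h_cpow (y : ℝ) (hy : 0 < y) : DifferentiableAt ℂ (fun s : ℂ => (y : ℂ) ^ (-s)) s :=
    differentiableAt_id.neg.const_cpow (.inl (by exact_mod_cast hy.ne'))
  have hs0 : s ≠ 0 := by rintro rfl; simp at hs
  exact ((((h_cpow _ Real.two_pi_pos).mul (h_gamma.div_const _)).mul (h_cpow x hx)).mul
    (by fun_prop)).div differentiableAt_id hs0

theorem norm_VkIntegrand_le {k m : ℕ} (hk : 0 < k) {x : ℝ} (hx : 0 < x) {s : ℂ}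
    (hs : 1 ≤ s.re) (hsm : s.re < m) :
    ‖VkIntegrand k x s‖ ≤
      ((k + m) / x) ^ s.re * Real.exp (s.re ^ 2) * Real.exp (-1 * s.im ^ 2) := by
  have hk' : (0 : ℝ) < k := by exact_mod_cast hk
  have hs0 : 0 < s.re := by linarith
  have hΓ := Real.Gamma_pos_of_pos hk'
  have h_two_pi : (2 * Real.pi) ^ (-s.re) ≤ 1 :=
    Real.rpow_le_one_of_one_le_of_nonpos (by linarith [Real.pi_gt_three]) (by linarith)
  have h_gamma : ‖Complex.Gamma (s + k)‖ / Real.Gamma k ≤ (k + m) ^ s.re := by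
    rw [div_le_iff₀ hΓ, mul_comm]
    refine (Complex.norm_Gamma_le (by simpa using by positivity)).trans ?_
    simpa [add_comm] using Real.Gamma_add_le hk' hs0 hsm
  have h_exp : ‖Complex.exp (s ^ 2)‖ = Real.exp (s.re ^ 2) * Real.exp (-1 * s.im ^ 2) := by
    rw [Complex.norm_exp, ← Real.exp_add]
    congr 1
    simp only [sq, Complex.mul_re]
    ring
  have h_norm : 1 ≤ ‖s‖ := hs.trans (Complex.re_le_norm s)
  have h_gamma_k : ‖Complex.Gamma k‖ = Real.Gamma k := by
    rw [← Complex.ofReal_natCast, Complex.Gamma_ofReal, Complex.norm_of_nonneg hΓ.le]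
  rw [VkIntegrand, norm_div, norm_mul, norm_mul, norm_mul, norm_div, h_exp, h_gamma_k,
    Complex.norm_cpow_eq_rpow_re_of_pos Real.two_pi_pos, Complex.norm_cpow_eq_rpow_re_of_pos hx,
    Complex.neg_re]
  refine (div_le_self (by positivity) h_norm).trans ?_
  calc _ ≤ 1 * (k + m : ℝ) ^ s.re * x ^ (-s.re) *
        (Real.exp (s.re ^ 2) * Real.exp (-1 * s.im ^ 2)) := by gcongr
    _ = _ := by
      rw [Real.div_rpow (by positivity) hx.le, Real.rpow_neg hx.le]
      ring

theorem Vk_eq_integral_vertical_line {k : ℕ} (hk : 0 < k) {x : ℝ} (hx : 0 < x) {a : ℝ}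
    (ha : 1 ≤ a) :
    Vk k x =
      ((1 / (2 * Real.pi) : ℝ) : ℂ) * ∫ t : ℝ, VkIntegrand k x (a + t * Complex.I) := by
  obtain ⟨m, hm⟩ := exists_nat_gt a
  have h_tendsto : Tendsto (fun t : ℝ => Real.exp (-1 * t ^ 2)) (cocompact ℝ) (𝓝 0) := by
    simpa using tendsto_rpow_abs_mul_exp_neg_mul_sq_cocompact one_pos 0
  have h_shift := integral_vertical_line_eq (f := VkIntegrand k x)
    (g := fun t => max 1 ((k + m) / x) ^ a * Real.exp (a ^ 2) * Real.exp (-1 * t ^ 2)) ha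
    (fun s hs => (differentiableAt_VkIntegrand k hx
      (one_pos.trans_le hs.1)).differentiableWithinAt)
    ((integrable_exp_neg_mul_sq one_pos).const_mul _)
    (by simpa using (h_tendsto.mono_left atTop_le_cocompact).const_mul _)
    (by simpa using (h_tendsto.mono_left atBot_le_cocompact).const_mul _)
    (fun s hs => by
      have hs0 : 0 ≤ s.re := zero_le_one.trans hs.1
      refine (norm_VkIntegrand_le hk hx hs.1 (hs.2.trans_lt hm)).trans ?_
      gcongr
      · calc ((k + m) / x) ^ s.re ≤ max 1 ((k + m) / x) ^ s.re := by
              gcongr; exact le_max_right _ _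
          _ ≤ max 1 ((k + m) / x) ^ a :=
              Real.rpow_le_rpow_of_exponent_le (le_max_left _ _) hs.2
      · exact hs.2)
  rw [← h_shift]
  simp only [Vk, VkIntegrand, Complex.ofReal_one]

theorem statement13 (A : ℝ) (hA : 1 ≤ A) :
    ∃ C : ℝ, 0 < C ∧
      ∀ k : ℕ, 2 ≤ k → ∀ ξ : ℝ, 0 < ξ → ‖Vk k ξ‖ ≤ C * ((k : ℝ) / ξ) ^ A := by
  obtain ⟨m, hm⟩ := exists_nat_gt A
  refine ⟨1 / (2 * Real.pi) * ((1 + m) ^ A * Real.exp (A ^ 2) * √(Real.pi / 1)),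
    by positivity, fun k hk ξ hξ => ?_⟩
  have hk1 : (1 : ℝ) ≤ k := by exact_mod_cast one_le_two.trans hk
  have h_integral : ‖∫ t : ℝ, VkIntegrand k ξ (A + t * Complex.I)‖ ≤
      ((k + m) / ξ) ^ A * Real.exp (A ^ 2) * √(Real.pi / 1) := by
    rw [← integral_gaussian, ← integral_const_mul]
    refine norm_integral_le_of_norm_le ((integrable_exp_neg_mul_sq one_pos).const_mul _)
      (.of_forall fun t => ?_)
    simpa using norm_VkIntegrand_le (k := k) (m := m) (by lia) hξ (s := A + t * Complex.I)
      (by simpa using hA) (by simpa using hm)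
  have h_rpow : ((k + m) / ξ) ^ A ≤ (1 + m : ℝ) ^ A * (k / ξ) ^ A := by
    rw [← Real.mul_rpow (by positivity) (by positivity), ← mul_div_assoc]
    gcongr
    nlinarith [(Nat.cast_nonneg m : (0 : ℝ) ≤ m)]
  rw [Vk_eq_integral_vertical_line (by lia) hξ hA, norm_mul,
    Complex.norm_of_nonneg (by positivity)]
  calc _ ≤ 1 / (2 * Real.pi) *
        ((1 + m : ℝ) ^ A * (k / ξ) ^ A * Real.exp (A ^ 2) * √(Real.pi / 1)) := by
        gcongr
        exact h_integral.trans (by gcongr)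
    _ = _ := by ring
end

section
/- For every ε ∈ (0, 1/2) there exists a constant C = C(ε) > 0 such that for every integer k ≥ 2 and every real ξ with 0 < ξ ≤ k, one has |V_k(ξ) − 1| ≤ C · (ξ/k)^{1/2 − ε}. -/
open MeasureTheory Set

lemma one_add_mul_I_ne_zero (t : ℝ) : 1 + (t : ℂ) * Complex.I ≠ 0 := by
  intro h
  simpa using congrArg Complex.re h

lemma integrable_exp_one_sub_sq : Integrable (fun t : ℝ => Real.exp (1 - t ^ 2)) := by
  have h := (integrable_exp_neg_mul_sq (b := 1) one_pos).const_mul (Real.exp 1)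
  refine h.congr (Filter.Eventually.of_forall fun t => ?_)
  simp only [← Real.exp_add]
  ring_nf

lemma norm_exp_sq_sub_mul (t u : ℝ) :
    ‖Complex.exp ((1 + (t : ℂ) * Complex.I) ^ 2 - (1 + (t : ℂ) * Complex.I) * u)‖ =
      Real.exp (1 - t ^ 2) * Real.exp (-u) := by
  rw [Complex.norm_exp, ← Real.exp_add]
  simp [pow_two]
  ring

lemma integral_exp_sq_sub_mul (u : ℝ) :
    ∫ t : ℝ, Complex.exp ((1 + (t : ℂ) * Complex.I) ^ 2 - (1 + (t : ℂ) * Complex.I) * u) =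
      ((√Real.pi * Real.exp (-(1 / 4) * u ^ 2) : ℝ) : ℂ) := by
  have h := integral_cexp_quadratic (b := -1) (by simp) (Complex.I * (2 - u)) (1 - u)
  have e : ∀ t : ℝ, (1 + (t : ℂ) * Complex.I) ^ 2 - (1 + (t : ℂ) * Complex.I) * u =
      -1 * (t : ℂ) ^ 2 + Complex.I * (2 - u) * t + (1 - u) := by
    intro t
    ring_nf
    simp only [Complex.I_sq]
    ring
  simp only [e]
  rw [h]
  push_cast
  congr 1
  · rw [Real.sqrt_eq_rpow, Complex.ofReal_cpow Real.pi_pos.le]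
    simp
  · congr 1
    rw [mul_pow, Complex.I_sq]
    ring

/-- The Mellin–Barnes integral of `e^{s²} / s` is a Gaussian tail. -/
lemma integral_exp_sq_sub_mul_div (u : ℝ) :
    ∫ t : ℝ, Complex.exp ((1 + (t : ℂ) * Complex.I) ^ 2 - (1 + (t : ℂ) * Complex.I) * u) /
        (1 + (t : ℂ) * Complex.I) =
      ((∫ v in Ioi u, √Real.pi * Real.exp (-(1 / 4) * v ^ 2) : ℝ) : ℂ) := by
  have hlap : ∀ t : ℝ,
      Complex.exp ((1 + (t : ℂ) * Complex.I) ^ 2 - (1 + (t : ℂ) * Complex.I) * u) /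
        (1 + (t : ℂ) * Complex.I) =
      ∫ v in Ioi u,
        Complex.exp ((1 + (t : ℂ) * Complex.I) ^ 2 - (1 + (t : ℂ) * Complex.I) * v) := by
    intro t
    have h := integral_exp_mul_complex_Ioi (a := -(1 + (t : ℂ) * Complex.I)) (by simp) u
    simp only [sub_eq_add_neg, Complex.exp_add, ← neg_mul]
    rw [integral_const_mul, h]
    field_simp [one_add_mul_I_ne_zero t]
  simp only [hlap]
  rw [integral_integral_swap]
  · simp only [integral_exp_sq_sub_mul]
    exact integral_ofReal
  · have h_int := integrable_exp_one_sub_sq.mul_prod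
      (show Integrable (fun v : ℝ => Real.exp (-v)) (volume.restrict (Ioi u)) from
        integrableOn_exp_neg_Ioi u)
    refine h_int.mono' ?_ (Filter.Eventually.of_forall fun p => ?_)
    · apply Measurable.aestronglyMeasurable
      unfold Function.uncurry
      fun_prop
    · exact (norm_exp_sq_sub_mul p.1 p.2).le

lemma integrable_exp_neg_mul_sub_sq (a : ℝ) :
    Integrable (fun v : ℝ => √Real.pi * Real.exp (-a * v - (1 / 4) * v ^ 2)) := by
  have h := (integrable_cexp_quadratic (b := 1 / 4) (by norm_num) (-a) 0).norm
  refine (h.congr (Filter.Eventually.of_forall fun v => ?_)).const_mul _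
  simp only [Complex.norm_exp]
  congr 1
  simp [pow_two]
  ring

lemma norm_integral_exp_sq_sub_mul_div_sub_le {a : ℝ} (ha : 0 < a) (u : ℝ) :
    ‖(∫ t : ℝ, Complex.exp ((1 + (t : ℂ) * Complex.I) ^ 2 - (1 + (t : ℂ) * Complex.I) * u) /
        (1 + (t : ℂ) * Complex.I)) - 2 * Real.pi‖ ≤
      (∫ v : ℝ, √Real.pi * Real.exp (-a * v - (1 / 4) * v ^ 2)) * Real.exp (a * u) := by
  have h_int : Integrable (fun v : ℝ => √Real.pi * Real.exp (-(1 / 4) * v ^ 2)) :=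
    (integrable_exp_neg_mul_sq (by norm_num)).const_mul _
  have htot : ∫ v : ℝ, √Real.pi * Real.exp (-(1 / 4) * v ^ 2) = 2 * Real.pi := by
    rw [integral_const_mul, integral_gaussian, ← Real.sqrt_mul Real.pi_pos.le,
      show Real.pi * (Real.pi / (1 / 4)) = (2 * Real.pi) ^ 2 by ring]
    exact Real.sqrt_sq (by positivity)
  have hsplit := integral_add_compl (measurableSet_Ioi (a := u)) h_int
  rw [htot] at hsplit
  rw [integral_exp_sq_sub_mul_div, norm_sub_rev, ← Complex.ofReal_ofNat, ← Complex.ofReal_mul,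
    ← Complex.ofReal_sub, ← hsplit, add_sub_cancel_left, Complex.norm_real, ← integral_mul_const]
  have hb := (integrable_exp_neg_mul_sub_sq a).mul_const (Real.exp (a * u))
  refine (norm_integral_le_of_norm_le hb.integrableOn ?_).trans
    (setIntegral_le_integral hb (Filter.Eventually.of_forall fun v => by positivity))
  filter_upwards [ae_restrict_mem measurableSet_Ioi.compl] with v hv
  have hv' : v ≤ u := by simpa using hv
  rw [Real.norm_of_nonneg (by positivity), mul_assoc, ← Real.exp_add]
  gcongr
  nlinarith

lemma Vk_integrand_eq {k : ℕ} (hk : 2 ≤ k) {x : ℝ} (hx : 0 < x) (t : ℝ) :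
    ((2 * Real.pi : ℝ) : ℂ) ^ (-(1 + (t : ℂ) * Complex.I)) *
        (Complex.Gamma (1 + (t : ℂ) * Complex.I + (k : ℂ)) / Complex.Gamma (k : ℂ)) *
        (x : ℂ) ^ (-(1 + (t : ℂ) * Complex.I)) *
        Complex.exp ((1 + (t : ℂ) * Complex.I) ^ 2) / (1 + (t : ℂ) * Complex.I) =
      (Complex.Gamma (k : ℂ))⁻¹ * ∫ y in Ioi (0 : ℝ),
        ((Real.exp (-y) * y ^ ((k : ℝ) - 1) : ℝ) : ℂ) *
          (Complex.exp ((1 + (t : ℂ) * Complex.I) ^ 2 -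
            (1 + (t : ℂ) * Complex.I) * (Real.log (2 * Real.pi * x / y) : ℝ)) /
              (1 + (t : ℂ) * Complex.I)) := by
  have hpi : 0 < 2 * Real.pi := by positivity
  rw [Complex.Gamma_eq_integral (by simp; positivity), Complex.GammaIntegral]
  have e : ∀ A B C G I s : ℂ, A * (I / G) * B * C / s = G⁻¹ * ((A * B * C / s) * I) := by
    intros
    ring
  rw [e, ← integral_const_mul]
  congr 1
  refine setIntegral_congr_fun measurableSet_Ioi fun y hy => ?_
  have hy : 0 < y := hy
  have hyc : (y : ℂ) ≠ 0 := by exact_mod_cast hy.ne'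
  have hk1 : ((y ^ ((k : ℝ) - 1) : ℝ) : ℂ) = Complex.exp (Real.log y * ((k : ℂ) - 1)) := by
    rw [Real.rpow_def_of_pos hy]
    push_cast
    rfl
  rw [Complex.ofReal_mul (Real.exp (-y)), hk1,
    Complex.cpow_def_of_ne_zero (by exact_mod_cast hpi.ne'),
    Complex.cpow_def_of_ne_zero (by exact_mod_cast hx.ne'), Complex.cpow_def_of_ne_zero hyc,
    ← Complex.ofReal_log hpi.le, ← Complex.ofReal_log hx.le, ← Complex.ofReal_log hy.le,
    Real.log_div (by positivity) hy.ne', Real.log_mul hpi.ne' hx.ne']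
  have e2 : ∀ A B C s E Y : ℂ, A * B * C / s * (E * Y) = E * (A * B * C * Y) / s := by
    intros
    ring
  have e3 : ∀ P E X s : ℂ, E * P * (X / s) = E * (P * X) / s := by
    intros
    ring
  rw [e2, e3]
  simp only [← Complex.exp_add]
  congr 3
  push_cast
  ring

lemma integrable_gamma_kernel {k : ℕ} (hk : 2 ≤ k) {x : ℝ} (hx : 0 < x) :
    Integrable (fun p : ℝ × ℝ =>
        ((Real.exp (-p.2) * p.2 ^ ((k : ℝ) - 1) : ℝ) : ℂ) *
          (Complex.exp ((1 + (p.1 : ℂ) * Complex.I) ^ 2 -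
            (1 + (p.1 : ℂ) * Complex.I) * (Real.log (2 * Real.pi * x / p.2) : ℝ)) /
              (1 + (p.1 : ℂ) * Complex.I)))
      (volume.prod (volume.restrict (Ioi 0))) := by
  have hG : IntegrableOn (fun y : ℝ => Real.exp (-y) * y ^ ((k : ℝ) + 1 - 1)) (Ioi 0) :=
    Real.GammaIntegral_convergent (by positivity)
  have h_int := integrable_exp_one_sub_sq.mul_prod (hG.div_const (2 * Real.pi * x))
  refine h_int.mono' ?_ ?_
  · apply Measurable.aestronglyMeasurable
    fun_prop
  · have hmem : ∀ᵐ p : ℝ × ℝ ∂(volume.prod (volume.restrict (Ioi 0))), p.2 ∈ Ioi (0 : ℝ) :=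
      Measure.quasiMeasurePreserving_snd.ae (ae_restrict_mem measurableSet_Ioi)
    filter_upwards [hmem] with p hp
    have hp : 0 < p.2 := hp
    rw [norm_mul, norm_div, norm_exp_sq_sub_mul, Complex.norm_real,
      Real.norm_of_nonneg (by positivity), Real.exp_neg (Real.log _),
      Real.exp_log (by positivity), add_sub_cancel_right]
    have h1 : 1 ≤ ‖1 + (p.1 : ℂ) * Complex.I‖ := by
      simpa using Complex.re_le_norm (1 + (p.1 : ℂ) * Complex.I)
    refine (mul_le_mul_of_nonneg_left (div_le_self (by positivity) h1) (by positivity)).trans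
      (le_of_eq ?_)
    rw [Real.rpow_sub_one hp.ne']
    field_simp

lemma Gamma_sub_le {k : ℕ} (hk : 2 ≤ k) {a : ℝ} (ha : 0 < a) (ha1 : a < 1) :
    Real.Gamma (k - a) ≤ Real.Gamma k * (2 / k) ^ a := by
  have hk' : (2 : ℝ) ≤ k := by exact_mod_cast hk
  have hk1 : (0 : ℝ) < k - 1 := by linarith
  have hk0 : (0 : ℝ) < k := by linarith
  have h := Real.Gamma_mul_add_mul_le_rpow_Gamma_mul_rpow_Gamma hk1 hk0 ha
    (sub_pos.2 ha1) (by ring)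
  rw [show a * ((k : ℝ) - 1) + (1 - a) * k = k - a by ring] at h
  refine h.trans ?_
  have hG := Real.Gamma_add_one hk1.ne'
  rw [sub_add_cancel] at hG
  have hGp := Real.Gamma_pos_of_pos hk0
  have hG1 : Real.Gamma ((k : ℝ) - 1) = Real.Gamma k * (1 / (k - 1)) := by
    rw [hG]
    field_simp
  rw [hG1, Real.mul_rpow hGp.le (by positivity), mul_right_comm, ← Real.rpow_add hGp,
    add_sub_cancel, Real.rpow_one]
  gcongr ?_ * ?_ ^ _
  rw [div_le_div_iff₀ hk1 hk0]
  linarith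

lemma norm_Vk_sub_one_le {k : ℕ} (hk : 2 ≤ k) {x a : ℝ} (hx : 0 < x) (ha : 0 < a) (ha1 : a < 1) :
    ‖Vk k x - 1‖ ≤ (2 * Real.pi)⁻¹ * (Real.Gamma k)⁻¹ *
      ((∫ v : ℝ, √Real.pi * Real.exp (-a * v - (1 / 4) * v ^ 2)) *
        (2 * Real.pi * x) ^ a * Real.Gamma (k - a)) := by
  have hk' : (2 : ℝ) ≤ k := by exact_mod_cast hk
  have hk0 : (0 : ℝ) < k := by linarith
  have hGp := Real.Gamma_pos_of_pos hk0
  have hpi := Real.pi_pos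
  have hF := integrable_gamma_kernel hk hx
  set J : ℝ → ℂ := fun u => ∫ t : ℝ,
    Complex.exp ((1 + (t : ℂ) * Complex.I) ^ 2 - (1 + (t : ℂ) * Complex.I) * u) /
        (1 + (t : ℂ) * Complex.I) with hJ
  have hV : Vk k x = ((2 * Real.pi)⁻¹ * (Real.Gamma k)⁻¹ : ℝ) * ∫ y in Ioi (0 : ℝ),
      ((Real.exp (-y) * y ^ ((k : ℝ) - 1) : ℝ) : ℂ) * J (Real.log (2 * Real.pi * x / y)) := by
    unfold Vk
    simp only [Vk_integrand_eq hk hx]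
    rw [integral_const_mul, integral_integral_swap hF]
    simp only [integral_const_mul]
    rw [← Complex.ofReal_natCast, Complex.Gamma_ofReal]
    push_cast
    ring
  have hJint : IntegrableOn (fun y : ℝ => ((Real.exp (-y) * y ^ ((k : ℝ) - 1) : ℝ) : ℂ) *
      J (Real.log (2 * Real.pi * x / y))) (Ioi 0) := by
    have := hF.integral_prod_right
    simp only [integral_const_mul] at this
    exact this
  have hw : IntegrableOn (fun y : ℝ => ((Real.exp (-y) * y ^ ((k : ℝ) - 1) : ℝ) : ℂ) *
      (2 * Real.pi)) (Ioi 0) :=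
    (Real.GammaIntegral_convergent hk0).ofReal.mul_const _
  have h1 : (1 : ℂ) = ((2 * Real.pi)⁻¹ * (Real.Gamma k)⁻¹ : ℝ) * ∫ y in Ioi (0 : ℝ),
      ((Real.exp (-y) * y ^ ((k : ℝ) - 1) : ℝ) : ℂ) * (2 * Real.pi) := by
    have hr : ∫ y in Ioi (0 : ℝ), ((Real.exp (-y) * y ^ ((k : ℝ) - 1) : ℝ) : ℂ) =
        (Real.Gamma k : ℂ) := by
      rw [Real.Gamma_eq_integral hk0]
      exact integral_ofReal
    rw [integral_mul_const, hr]
    have : (Real.Gamma k : ℂ) ≠ 0 := by exact_mod_cast hGp.ne'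
    have : (Real.pi : ℂ) ≠ 0 := by exact_mod_cast hpi.ne'
    push_cast
    field_simp
  rw [hV, h1, ← mul_sub, ← integral_sub hJint hw, norm_mul, Complex.norm_real,
    Real.norm_of_nonneg (by positivity)]
  gcongr
  have hka : 0 < (k : ℝ) - a := by linarith
  rw [Real.Gamma_eq_integral hka, ← integral_const_mul]
  refine norm_integral_le_of_norm_le
    ((Real.GammaIntegral_convergent hka).const_mul _) ?_
  filter_upwards [ae_restrict_mem measurableSet_Ioi] with y hy
  have hy : 0 < y := hy
  rw [← mul_sub, norm_mul, Complex.norm_real, Real.norm_of_nonneg (by positivity)]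
  refine (mul_le_mul_of_nonneg_left
    (norm_integral_exp_sq_sub_mul_div_sub_le ha _) (by positivity)).trans (le_of_eq ?_)
  rw [mul_comm a (Real.log _), ← Real.rpow_def_of_pos (by positivity),
    Real.div_rpow (by positivity) hy.le, show (k : ℝ) - a - 1 = (k - 1) - a by ring,
    Real.rpow_sub hy _ a]
  ring

theorem statement14 (ε : ℝ) (hε : ε ∈ Set.Ioo 0 (1 / 2 : ℝ)) :
    ∃ C : ℝ, 0 < C ∧
      ∀ k : ℕ, 2 ≤ k → ∀ ξ : ℝ, 0 < ξ → ξ ≤ (k : ℝ) →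
        ‖Vk k ξ - 1‖ ≤ C * (ξ / (k : ℝ)) ^ (1 / 2 - ε) := by
  obtain ⟨h0, h1⟩ := hε
  have ha : 0 < 1 / 2 - ε := by linarith
  have ha1 : 1 / 2 - ε < 1 := by linarith
  generalize 1 / 2 - ε = a at ha ha1 ⊢
  set M := ∫ v : ℝ, √Real.pi * Real.exp (-a * v - (1 / 4) * v ^ 2) with hM
  have hM0 : 0 ≤ M := integral_nonneg fun v => by positivity
  have hpi := Real.pi_pos
  refine ⟨(2 * Real.pi)⁻¹ * M * (4 * Real.pi) ^ a + 1, by positivity, fun k hk ξ hξ _ => ?_⟩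
  have hk0 : (0 : ℝ) < k := by
    have : (2 : ℝ) ≤ k := by exact_mod_cast hk
    linarith
  have hGp := Real.Gamma_pos_of_pos hk0
  calc ‖Vk k ξ - 1‖
      ≤ (2 * Real.pi)⁻¹ * (Real.Gamma k)⁻¹ * (M * (2 * Real.pi * ξ) ^ a * Real.Gamma (k - a)) :=
        norm_Vk_sub_one_le hk hξ ha ha1
    _ ≤ (2 * Real.pi)⁻¹ * (Real.Gamma k)⁻¹ *
          (M * (2 * Real.pi * ξ) ^ a * (Real.Gamma k * (2 / k) ^ a)) := by
        gcongr
        exact Gamma_sub_le hk ha ha1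
    _ = (2 * Real.pi)⁻¹ * M * ((2 * Real.pi * ξ) ^ a * (2 / k) ^ a) := by
        field_simp
    _ = (2 * Real.pi)⁻¹ * M * (4 * Real.pi) ^ a * (ξ / k) ^ a := by
        rw [← Real.mul_rpow (by positivity) (by positivity), mul_assoc _ (_ ^ a) (_ ^ a),
          ← Real.mul_rpow (by positivity) (by positivity)]
        congr 2
        ring
    _ ≤ ((2 * Real.pi)⁻¹ * M * (4 * Real.pi) ^ a + 1) * (ξ / k) ^ a := by
        gcongr
        linarith
end

section
/- Let h : ℝ → ℝ be a smooth, compactly supported function. Then for every B > 0 there exists a constant C = C(h, B) > 0 such that for all real K ≥ 2, | Σ_{k ∈ ℤ} h((2k−1)/K) − (K/2)·∫_ℝ h(x) dx | ≤ C · K^{−B}. -/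
open scoped FourierTransform SchwartzMap in
/-- Poisson summation, with the zero frequency isolated and the other frequencies dominated
termwise by `b`. -/
theorem SchwartzMap.norm_tsum_add_int_sub_fourier_zero_le (g : 𝓢(ℝ, ℂ)) (x : ℝ) {b : ℤ → ℝ}
    (hb : Summable b) (h_zero : 0 ≤ b 0) (h_le : ∀ n : ℤ, n ≠ 0 → ‖𝓕 (g : ℝ → ℂ) n‖ ≤ b n) :
    ‖(∑' n : ℤ, g (x + n)) - 𝓕 (g : ℝ → ℂ) 0‖ ≤ ∑' n : ℤ, b n := by
  have norm_term (n : ℤ) :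
      ‖𝓕 (g : ℝ → ℂ) n * fourier n (x : UnitAddCircle)‖ = ‖𝓕 (g : ℝ → ℂ) n‖ := by
    rw [norm_mul, fourier_apply, Circle.norm_coe, mul_one]
  have hsum : Summable fun n : ℤ => 𝓕 (g : ℝ → ℂ) n * fourier n (x : UnitAddCircle) := by
    refine Summable.of_norm_bounded_eventually hb ?_
    filter_upwards [(Set.finite_singleton (0 : ℤ)).compl_mem_cofinite] with n hn
    exact (norm_term n).trans_le (h_le n hn)
  rw [g.tsum_eq_tsum_fourier x]
  simp only [SchwartzMap.fourier_coe]
  rw [hsum.tsum_eq_add_tsum_ite 0]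
  simp only [Int.cast_zero, fourier_zero, mul_one, add_sub_cancel_left]
  refine tsum_of_norm_bounded hb.hasSum fun n => ?_
  split_ifs with hn
  · simpa [hn] using h_zero
  · exact (norm_term n).trans_le (h_le n hn)

open scoped FourierTransform in
theorem Real.fourier_comp_inv_mul {E : Type*} [NormedAddCommGroup E] [NormedSpace ℂ E]
    (f : ℝ → E) {L : ℝ} (hL : L ≠ 0) (w : ℝ) :
    𝓕 (fun x => f (L⁻¹ * x)) w = |L| • 𝓕 f (L * w) := by
  rw [Real.fourier_real_eq, Real.fourier_real_eq, ← inv_inv |L|, ← abs_inv, ← abs_inv,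
    ← MeasureTheory.Measure.integral_comp_mul_left _ L⁻¹]
  congr 1 with x
  congr 3
  field_simp

open scoped FourierTransform SchwartzMap in
theorem SchwartzMap.exists_norm_fourier_dilation_le (f : 𝓢(ℝ, ℂ)) (B : ℝ) :
    ∃ b : ℤ → ℝ, Summable b ∧ (∀ n, 0 ≤ b n) ∧ ∀ L : ℝ, 1 ≤ L → ∀ n : ℤ, n ≠ 0 →
      ‖𝓕 (fun x => f (L⁻¹ * x)) (n : ℝ)‖ ≤ b n * L ^ (-B) := by
  set M : ℕ := ⌈B⌉₊ + 2 with hM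
  obtain ⟨A, hA, hdecay⟩ := (𝓕 f).decay M 0
  simp only [norm_iteratedFDeriv_zero, SchwartzMap.fourier_coe, Real.norm_eq_abs] at hdecay
  refine ⟨fun n => A * |(n : ℝ)| ^ (-(M : ℝ)), ?_, fun n => by positivity, fun L hL n hn => ?_⟩
  · refine (Real.summable_abs_int_rpow ?_).mul_left A
    rw [hM]
    exact_mod_cast (by omega : 1 < ⌈B⌉₊ + 2)
  · have hL0 : 0 < L := by linarith
    have hn0 : 0 < |(n : ℝ)| := by positivity
    have hpow : L * L ^ B ≤ L ^ M := by
      calc L * L ^ B = L ^ (1 + B) := by rw [Real.rpow_add hL0, Real.rpow_one]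
        _ ≤ L ^ (M : ℝ) := by
          refine Real.rpow_le_rpow_of_exponent_le hL ?_
          rw [hM]
          push_cast
          linarith [Nat.le_ceil B]
        _ = L ^ M := Real.rpow_natCast L M
    have hd := hdecay (L * n)
    rw [abs_mul, abs_of_pos hL0, mul_pow] at hd
    beta_reduce
    rw [Real.fourier_comp_inv_mul _ hL0.ne', norm_smul, Real.norm_eq_abs, abs_abs,
      abs_of_pos hL0, Real.rpow_neg hL0.le, Real.rpow_neg hn0.le, Real.rpow_natCast,
      ← div_eq_mul_inv, ← div_eq_mul_inv, div_div, le_div_iff₀ (by positivity)]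
    calc L * ‖𝓕 (f : ℝ → ℂ) (L * n)‖ * (|(n : ℝ)| ^ M * L ^ B)
        = L * L ^ B * (|(n : ℝ)| ^ M * ‖𝓕 (f : ℝ → ℂ) (L * n)‖) := by ring
      _ ≤ L ^ M * (|(n : ℝ)| ^ M * ‖𝓕 (f : ℝ → ℂ) (L * n)‖) := by gcongr
      _ ≤ A := by rwa [← mul_assoc]

theorem statement15 (h : ℝ → ℝ) (hs : ContDiff ℝ (⊤ : ℕ∞) h) (hc : HasCompactSupport h) :
    ∀ B : ℝ, 0 < B →
      ∃ C : ℝ, 0 < C ∧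
        ∀ K : ℝ, 2 ≤ K →
          |(∑' k : ℤ, h ((2 * (k : ℝ) - 1) / K)) - K / 2 * ∫ x : ℝ, h x|
            ≤ C * K ^ (-B) := by
  intro B _
  have hs' : ContDiff ℝ (⊤ : ℕ∞) fun x => (h x : ℂ) := Complex.ofRealCLM.contDiff.comp hs
  have hc' : HasCompactSupport fun x => (h x : ℂ) :=
    HasCompactSupport.comp_left (g := Complex.ofReal) hc Complex.ofReal_zero
  obtain ⟨b, hb, hb0, hle⟩ := (hc'.toSchwartzMap hs').exists_norm_fourier_dilation_le B
  obtain ⟨S, hS⟩ := hb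
  have hS0 : 0 ≤ S := hS.nonneg hb0
  refine ⟨(S + 1) * 2 ^ B, by positivity, fun K hK => ?_⟩
  have hL : 1 ≤ K / 2 := by linarith
  have hL0 : (K / 2) ≠ 0 := by linarith
  have hgs : ContDiff ℝ (⊤ : ℕ∞) fun x => (h ((K / 2)⁻¹ * x) : ℂ) :=
    hs'.comp (contDiff_const.mul contDiff_id)
  have hgc : HasCompactSupport fun x => (h ((K / 2)⁻¹ * x) : ℂ) := by
    have := hc'.comp_smul (inv_ne_zero hL0)
    simpa only [smul_eq_mul] using this
  have key := (hgc.toSchwartzMap hgs).norm_tsum_add_int_sub_fourier_zero_le (-(1 / 2))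
    (hS.summable.mul_right ((K / 2) ^ (-B))) (mul_nonneg (hb0 0) (by positivity)) (hle (K / 2) hL)
  have hzero : FourierTransform.fourier (fun x => (h ((K / 2)⁻¹ * x) : ℂ)) (0 : ℝ)
      = ((K / 2 * ∫ x, h x : ℝ) : ℂ) := by
    rw [Real.fourier_comp_inv_mul (fun x => (h x : ℂ)) hL0, mul_zero, Real.fourier_real_eq,
      abs_of_pos (by linarith)]
    simp [integral_complex_ofReal]
  have hterm (n : ℤ) : (K / 2)⁻¹ * (-(1 / 2) + n) = (2 * n - 1) / K := by
    field_simp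
    ring
  have hcoe : ⇑(hgc.toSchwartzMap hgs) = fun x => (h ((K / 2)⁻¹ * x) : ℂ) := rfl
  rw [hcoe, hzero] at key
  simp only [hterm] at key
  rw [← Complex.ofReal_tsum, ← Complex.ofReal_sub, Complex.norm_real, Real.norm_eq_abs,
    tsum_mul_right, hS.tsum_eq] at key
  refine key.trans ?_
  rw [Real.div_rpow (by linarith) zero_le_two, Real.rpow_neg zero_le_two, div_inv_eq_mul,
    mul_comm (K ^ _), ← mul_assoc]
  gcongr
  linarith
end
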